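/- For every probability vector p and every ε > 0 there exist c = c(p) > 0 and a constant A such that whenever K ≥ (C_p^− + ε)·log N, one has E[|E(G,G')|] ≤ A·N^{−c·ε}, where G and G' are the shuffle graphs of two independent p-random sequences of N strings of length K. -/

import Mathlib

open Finset

namespace RiffleShuffle

/-- `phi p t = ∑ i, p i ^ t`. -/
noncomputable def phi {k : ℕ} (p : Fin k → ℝ) (t : ℝ) : ℝ := ∑ i, p i ^ t

/-- `psi p t = - log (phi p t)`. -/
noncomputable def psi {k : ℕ} (p : Fin k → ℝ) (t : ℝ) : ℝ := - Real.log (phi p t)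

/-- The maximal entry of `p`. -/
noncomputable def pmax {k : ℕ} (p : Fin k → ℝ) : ℝ := ⨆ i, p i

/-- The minimal entry of `p`. -/
noncomputable def pmin {k : ℕ} (p : Fin k → ℝ) : ℝ := ⨅ i, p i

/-- `C_p = (3+θ)/(4 ψ_p(2))`, where `θ` is the solution of `φ_p(θ) = φ_p(2)²`. -/
noncomputable def Cmain {k : ℕ} (p : Fin k → ℝ) (θ : ℝ) : ℝ := (3 + θ) / (4 * psi p 2)

/-- `C̃_p = 1/log(1/p_max)`. -/
noncomputable def Ctilde {k : ℕ} (p : Fin k → ℝ) : ℝ := 1 / Real.log (1 / pmax p)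

/-- `C̄_p = max(C̃_p, C_p)`. -/
noncomputable def Cbar {k : ℕ} (p : Fin k → ℝ) (θ : ℝ) : ℝ := max (Ctilde p) (Cmain p θ)

/-- Strings of length `K` over the alphabet `{0,…,k-1}`. -/
abbrev Str (k K : ℕ) := Fin K → Fin k

/-- Probability of an individual string, all digits i.i.d. with law `p`. -/
noncomputable def strP {k : ℕ} (p : Fin k → ℝ) {K : ℕ} (s : Str k K) : ℝ := ∏ j, p (s j)

/-- Probability of a tuple of `N` i.i.d. `p`-random strings. -/
noncomputable def seqP {k : ℕ} (p : Fin k → ℝ) {N K : ℕ} (ω : Fin N → Str k K) : ℝ :=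
  ∏ i, strP p (ω i)

/-- The base-`k` value of a string; comparing these values is exactly the lexicographic
order on strings of the same length. -/
def lexVal {k K : ℕ} (s : Str k K) : ℕ := ∑ j : Fin K, (s j : ℕ) * k ^ (K - 1 - (j : ℕ))

/-- The lexicographically sorted rearrangement of a tuple of strings. -/
noncomputable def sortedSeq {k N K : ℕ} (ω : Fin N → Str k K) : Fin N → Str k K :=
  fun i => ω (Tuple.sort (fun j => lexVal (ω j)) i)

/-- The edge set of the shuffle graph of a (sorted) sequence of strings: the edge between
`i` and `i+1` is present iff `s i = s (i+1)`; edges are recorded as pairs `(i, i+1)`. -/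
def edgeSet {k N K : ℕ} (s : Fin N → Str k K) : Finset (Fin N × Fin N) :=
  univ.filter (fun e => (e.2 : ℕ) = (e.1 : ℕ) + 1 ∧ s e.1 = s e.2)

/-- `s` begins with two digits equal to `d`. -/
def beginsWith2 {k : ℕ} (d : Fin k) {K : ℕ} (s : Str k K) : Prop :=
  ∃ h : 2 ≤ K, s ⟨0, by omega⟩ = d ∧ s ⟨1, by omega⟩ = d

instance {k K : ℕ} (d : Fin k) (s : Str k K) : Decidable (beginsWith2 d s) :=
  exists_prop_decidable _

section Strings

variable {k K : ℕ}

lemma sum_str_succ {M : Type*} [AddCommMonoid M] (f : Str k (K + 1) → M) :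
    ∑ s, f s = ∑ a : Fin k, ∑ s : Str k K, f (Fin.cons a s : Fin (K + 1) → Fin k) := by
  rw [← (Fin.consEquiv (fun _ => Fin k)).sum_comp, Fintype.sum_prod_type]
  rfl

lemma lexVal_cons (a : Fin k) (s : Str k K) :
    lexVal (Fin.cons a s : Str k (K + 1)) = a * k ^ K + lexVal s := by
  simp only [lexVal, Fin.sum_univ_succ, Fin.cons_zero, Fin.cons_succ, Fin.val_zero, Fin.val_succ]
  congr 1
  refine Finset.sum_congr rfl fun j _ => ?_
  congr 2
  omega

lemma lexVal_lt (s : Str k K) : lexVal s < k ^ K := by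
  induction K with
  | zero => simp [lexVal]
  | succ K ih =>
    rw [← Fin.cons_self_tail s, lexVal_cons]
    have h1 := ih (Fin.tail s)
    have h2 : (s 0 : ℕ) + 1 ≤ k := (s 0).2
    have h3 := Nat.mul_le_mul_right (k ^ K) h2
    rw [pow_succ]
    nlinarith

lemma lexVal_cons_lt_cons {a b : Fin k} {s t : Str k K} :
    lexVal (Fin.cons b t : Str k (K + 1)) < lexVal (Fin.cons a s : Str k (K + 1)) ↔
      b < a ∨ b = a ∧ lexVal t < lexVal s := by
  rw [lexVal_cons, lexVal_cons]
  have hs := lexVal_lt s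
  have ht := lexVal_lt t
  rcases lt_trichotomy b a with h | h | h
  · have h3 := Nat.mul_le_mul_right (k ^ K) (show (b : ℕ) + 1 ≤ a from h)
    simp only [h, true_or, iff_true]
    nlinarith
  · simp [h]
  · have h3 := Nat.mul_le_mul_right (k ^ K) (show (a : ℕ) + 1 ≤ b from h)
    simp only [h.not_gt, h.ne', false_or, false_and, iff_false, not_lt]
    nlinarith

lemma lexVal_injective : Function.Injective (lexVal : Str k K → ℕ) := by
  induction K with
  | zero => exact fun s t _ => Subsingleton.elim s t
  | succ K ih =>
    intro s t h
    rw [← Fin.cons_self_tail s, ← Fin.cons_self_tail t] at h ⊢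
    have h1 := lexVal_cons_lt_cons.not.1 h.not_lt
    have h2 := lexVal_cons_lt_cons.not.1 h.not_gt
    push Not at h1 h2
    have h3 : s 0 = t 0 := le_antisymm h2.1 h1.1
    rw [h3, ih (le_antisymm (h2.2 h3.symm) (h1.2 h3))]

end Strings

section Distribution

variable {k K : ℕ} (p : Fin k → ℝ)

lemma strP_cons (a : Fin k) (s : Str k K) :
    strP p (Fin.cons a s : Str k (K + 1)) = p a * strP p s := by
  simp [strP, Fin.prod_univ_succ]

/-- The probability that a random string is lexicographically smaller than `s`. -/
noncomputable def lexCdf (s : Str k K) : ℝ :=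
  ∑ t : Str k K, if lexVal t < lexVal s then strP p t else 0

lemma lexCdf_cons (hsum : ∑ s : Str k K, strP p s = 1) (a : Fin k) (s : Str k K) :
    lexCdf p (Fin.cons a s : Str k (K + 1)) = ∑ b with b < a, p b + p a * lexCdf p s := by
  have h : ∀ b : Fin k, (∑ t : Str k K, if lexVal (Fin.cons b t : Str k (K + 1)) <
      lexVal (Fin.cons a s : Str k (K + 1)) then strP p (Fin.cons b t : Str k (K + 1)) else 0) =
      (if b < a then p b else 0) + if b = a then p a * lexCdf p s else 0 := by
    intro b
    simp only [lexVal_cons_lt_cons, strP_cons]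
    rcases lt_trichotomy b a with h | h | h
    · simp [h, h.ne, ← Finset.mul_sum, hsum]
    · simp [h, lexCdf, Finset.mul_sum]
    · simp [h.not_gt, h.ne']
  rw [lexCdf, sum_str_succ, Finset.sum_congr rfl fun b _ => h b, Finset.sum_add_distrib,
    Finset.sum_filter]
  simp

variable {p}

lemma strP_pos (hpos : ∀ i, 0 < p i) (s : Str k K) : 0 < strP p s :=
  Finset.prod_pos fun _ _ => hpos _

lemma sum_strP (hsum : ∑ i, p i = 1) : ∑ s : Str k K, strP p s = 1 := by
  induction K with
  | zero => simp [strP]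
  | succ K ih => simp [sum_str_succ, strP_cons, ← Finset.mul_sum, ih, hsum]

lemma sum_strP_sq : ∑ s : Str k K, strP p s ^ 2 = (∑ i, p i ^ 2) ^ K := by
  induction K with
  | zero => simp [strP]
  | succ K ih =>
    simp only [sum_str_succ, strP_cons, mul_pow, ← Finset.mul_sum, ih, pow_succ (∑ i, p i ^ 2)]
    rw [← Finset.sum_mul, mul_comm]

lemma lexCdf_nonneg (hpos : ∀ i, 0 < p i) (s : Str k K) : 0 ≤ lexCdf p s :=
  Finset.sum_nonneg fun t _ => by split_ifs <;> simp [(strP_pos hpos t).le]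

lemma sum_ite_lexVal_le (s : Str k K) :
    ∑ t : Str k K, (if lexVal t < lexVal s ∨ t = s then strP p t else 0) =
      lexCdf p s + strP p s := by
  have h : ∀ t : Str k K, (if lexVal t < lexVal s ∨ t = s then strP p t else 0) =
      (if lexVal t < lexVal s then strP p t else 0) + if t = s then strP p s else 0 := by
    intro t
    by_cases h : t = s
    · simp [h]
    · simp [h]
  rw [Finset.sum_congr rfl fun t _ => h t, Finset.sum_add_distrib]
  simp [lexCdf]

lemma lexCdf_add_strP_le_one (hpos : ∀ i, 0 < p i) (hsum : ∑ i, p i = 1) (s : Str k K) :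
    lexCdf p s + strP p s ≤ 1 := by
  rw [← sum_ite_lexVal_le, ← sum_strP (K := K) hsum]
  refine Finset.sum_le_sum fun t _ => ?_
  split_ifs <;> simp [(strP_pos hpos t).le]

end Distribution

section Pairs

variable {k K N : ℕ}

/-- The string `t` at index `m` precedes the string `s` at index `j` in the stable sorted order. -/
abbrev Precedes (s : Str k K) (j m : Fin N) (t : Str k K) : Prop :=
  lexVal t < lexVal s ∨ t = s ∧ m < j

/-- The number of entries of `ω` that precede the string `s` at index `j`. -/
def rank (ω : Fin N → Str k K) (s : Str k K) (j : Fin N) : ℕ :=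
  #{m | Precedes s j m (ω m)}

/-- The probability that entries `j` and `l` both equal `s` and that entry `j` has rank `i`. -/
noncomputable def pairMass (p : Fin k → ℝ) (j l : Fin N) (s : Str k K) (i : ℕ) : ℝ :=
  ∑ ω : Fin N → Str k K, if ω j = s ∧ ω l = s ∧ rank ω s j = i then seqP p ω else 0

/-- The probability that entry `m` precedes the string `s` at index `j`. -/
noncomputable def precProb (p : Fin k → ℝ) (s : Str k K) (j m : Fin N) : ℝ :=
  ∑ t : Str k K, if Precedes s j m t then strP p t else 0

lemma precProb_eq (p : Fin k → ℝ) (s : Str k K) (j m : Fin N) :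
    precProb p s j m = lexCdf p s + if m < j then strP p s else 0 := by
  unfold precProb
  split_ifs with h
  · simp [Precedes, h, ← sum_ite_lexVal_le]
  · simp [Precedes, h, lexCdf]

lemma sum_prod_fun {R : Type*} [CommSemiring R] (h : Fin N → Str k K → R) :
    ∑ ω : Fin N → Str k K, ∏ m, h m (ω m) = ∏ m, ∑ s, h m s := by
  rw [Finset.prod_univ_sum]
  simp

lemma sum_seqP_mul_pow_rank {𝕜 : Type*} [RCLike 𝕜] {p : Fin k → ℝ} (hsum : ∑ i, p i = 1)
    {j l : Fin N} (hjl : j < l) (s : Str k K) (z : 𝕜) :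
    ∑ ω : Fin N → Str k K, (if ω j = s ∧ ω l = s then (seqP p ω : 𝕜) * z ^ rank ω s j else 0) =
      (strP p s : 𝕜) ^ 2 *
        ∏ m ∈ (univ.erase j).erase l, (1 + (precProb p s j m : 𝕜) * (z - 1)) := by
  let h : Fin N → Str k K → 𝕜 := fun m t => (strP p t : 𝕜) *
    if m = j ∨ m = l then (if t = s then 1 else 0) else (if Precedes s j m t then z else 1)
  have hl : l ∈ univ.erase j := Finset.mem_erase.2 ⟨hjl.ne', Finset.mem_univ _⟩
  have h1 : ∀ ω : Fin N → Str k K,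
      (if ω j = s ∧ ω l = s then (seqP p ω : 𝕜) * z ^ rank ω s j else 0) = ∏ m, h m (ω m) := by
    intro ω
    split_ifs with hω
    · have h2 : ∀ m, h m (ω m) = (strP p (ω m) : 𝕜) * if Precedes s j m (ω m) then z else 1 := by
        intro m
        by_cases hm : m = j ∨ m = l
        · have h3 : ω m = s := by rcases hm with rfl | rfl <;> simp [hω]
          have h4 : ¬ m < j := by rcases hm with rfl | rfl <;> simp [hjl.le]
          simp [h, hm, h3, h4]
        · simp [h, hm]
      rw [Finset.prod_congr rfl fun m _ => h2 m, Finset.prod_mul_distrib, Finset.prod_ite]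
      simp [seqP, rank]
    · rw [not_and_or] at hω
      rcases hω with hω | hω
      · exact (Finset.prod_eq_zero (Finset.mem_univ j) (by simp [h, hω])).symm
      · exact (Finset.prod_eq_zero (Finset.mem_univ l) (by simp [h, hω])).symm
  have h5 : ∀ m ∈ (univ.erase j).erase l,
      ∑ t, h m t = 1 + (precProb p s j m : 𝕜) * (z - 1) := by
    intro m hm
    simp only [Finset.mem_erase, Finset.mem_univ, and_true] at hm
    have h6 : ∀ t, h m t = (strP p t : 𝕜) +
        ((if Precedes s j m t then strP p t else 0 : ℝ) : 𝕜) * (z - 1) := by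
      intro t
      simp only [h, hm, or_self, if_false]
      split_ifs <;> push_cast <;> ring
    rw [Finset.sum_congr rfl fun t _ => h6 t, Finset.sum_add_distrib, ← Finset.sum_mul, precProb]
    congr 1
    · exact_mod_cast congrArg (RCLike.ofReal : ℝ → 𝕜) (sum_strP hsum)
    · push_cast
      rfl
  rw [Finset.sum_congr rfl fun ω _ => h1 ω, sum_prod_fun, ← Finset.mul_prod_erase _ _
    (Finset.mem_univ j), ← Finset.mul_prod_erase _ _ hl, Finset.prod_congr rfl h5]
  simp [h, sq, mul_assoc]

lemma seqP_nonneg {p : Fin k → ℝ} (hpos : ∀ i, 0 < p i) (ω : Fin N → Str k K) : 0 ≤ seqP p ω :=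
  Finset.prod_nonneg fun _ _ => (strP_pos hpos _).le

lemma sum_seqP {p : Fin k → ℝ} (hsum : ∑ i, p i = 1) :
    ∑ ω : Fin N → Str k K, seqP p ω = 1 := by
  simp only [seqP]
  rw [sum_prod_fun fun _ => strP p]
  simp [sum_strP hsum]

lemma pairMass_nonneg {p : Fin k → ℝ} (hpos : ∀ i, 0 < p i) (j l : Fin N) (s : Str k K) (i : ℕ) :
    0 ≤ pairMass p j l s i :=
  Finset.sum_nonneg fun ω _ => by split_ifs <;> simp [seqP_nonneg hpos]

lemma sum_pairMass_le {p : Fin k → ℝ} (hpos : ∀ i, 0 < p i) (hsum : ∑ i, p i = 1)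
    {j l : Fin N} (hjl : j < l) (s : Str k K) (I : Finset ℕ) :
    ∑ i ∈ I, pairMass p j l s i ≤ strP p s ^ 2 := by
  have h := sum_seqP_mul_pow_rank (𝕜 := ℝ) hsum hjl s 1
  simp only [one_pow, mul_one, sub_self, mul_zero, add_zero, Finset.prod_const_one,
    RCLike.ofReal_real_eq_id, id] at h
  rw [← h]
  simp only [pairMass]
  rw [Finset.sum_comm]
  refine Finset.sum_le_sum fun ω _ => ?_
  by_cases hω : ω j = s ∧ ω l = s
  · simp only [hω, true_and, and_self, if_true, Finset.sum_ite_eq]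
    split_ifs <;> simp [seqP_nonneg hpos]
  · rw [if_neg hω]
    refine (Finset.sum_eq_zero fun i _ => if_neg fun h => hω ⟨h.1, h.2.1⟩).le

/-- Markov's inequality for the exponential moment of the rank. -/
lemma pairMass_le_exp {p : Fin k → ℝ} (hpos : ∀ i, 0 < p i) (hsum : ∑ i, p i = 1)
    {j l : Fin N} (hjl : j < l) (s : Str k K) (i : ℕ) (u : ℝ) :
    pairMass p j l s i ≤ strP p s ^ 2 * (Real.exp (-(u * i)) *
        ∏ m ∈ (univ.erase j).erase l, (1 + precProb p s j m * (Real.exp u - 1))) := by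
  have h := sum_seqP_mul_pow_rank (𝕜 := ℝ) hsum hjl s (Real.exp u)
  simp only [RCLike.ofReal_real_eq_id, id] at h
  rw [mul_left_comm, ← h, Finset.mul_sum]
  refine Finset.sum_le_sum fun ω _ => ?_
  by_cases hω : ω j = s ∧ ω l = s
  · simp only [hω, true_and, and_self, if_true]
    split_ifs with hi
    · rw [hi, ← Real.exp_nat_mul, mul_left_comm, ← Real.exp_add]
      apply le_of_eq
      ring_nf
      simp
    · have := seqP_nonneg hpos ω
      positivity
  · rw [if_neg hω, if_neg fun h => hω ⟨h.1, h.2.1⟩, mul_zero]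

end Pairs

section RankBounds

lemma one_add_mul_exp_sub_one_le {x u V : ℝ} (hx0 : 0 ≤ x) (hx1 : x ≤ 1) (hu : |u| ≤ 1)
    (hV : x * (1 - x) ≤ V) :
    1 + x * (Real.exp u - 1) ≤ Real.exp (u * x + u ^ 2 * V) := by
  have key : ∀ y : ℝ, |y| ≤ 1 → Real.exp y ≤ 1 + y + y ^ 2 := fun y hy => by
    linarith [(abs_le.1 (Real.abs_exp_sub_one_sub_id_le hy)).2]
  have h1 := key (-(u * x)) (by
    rw [abs_neg, abs_mul, abs_of_nonneg hx0]
    exact mul_le_one₀ hu hx0 hx1)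
  have h2 := key (u * (1 - x)) (by
    rw [abs_mul, abs_of_nonneg (sub_nonneg.2 hx1)]
    exact mul_le_one₀ hu (sub_nonneg.2 hx1) (by linarith))
  have h3 : 1 + x * (Real.exp u - 1) = Real.exp (u * x) *
      ((1 - x) * Real.exp (-(u * x)) + x * Real.exp (u * (1 - x))) := by
    rw [mul_add, mul_left_comm, mul_left_comm (Real.exp (u * x)), ← Real.exp_add, ← Real.exp_add]
    ring_nf
    simp
    ring
  rw [h3, Real.exp_add]
  refine mul_le_mul_of_nonneg_left ?_ (Real.exp_pos _).le
  calc (1 - x) * Real.exp (-(u * x)) + x * Real.exp (u * (1 - x))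
      ≤ (1 - x) * (1 + -(u * x) + (-(u * x)) ^ 2) +
        x * (1 + u * (1 - x) + (u * (1 - x)) ^ 2) := by
        have := sub_nonneg.2 hx1
        gcongr
    _ = u ^ 2 * (x * (1 - x)) + 1 := by ring
    _ ≤ u ^ 2 * V + 1 := by gcongr
    _ ≤ Real.exp (u ^ 2 * V) := Real.add_one_le_exp _

variable {k K N : ℕ} {p : Fin k → ℝ}

lemma precProb_mem (hpos : ∀ i, 0 < p i) (hsum : ∑ i, p i = 1) (s : Str k K) (j m : Fin N) :
    lexCdf p s ≤ precProb p s j m ∧ precProb p s j m ≤ lexCdf p s + strP p s ∧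
      0 ≤ precProb p s j m ∧ precProb p s j m ≤ 1 := by
  have h1 := strP_pos hpos s
  have h2 := lexCdf_nonneg hpos s
  have h3 := lexCdf_add_strP_le_one hpos hsum s
  rw [precProb_eq]
  split_ifs <;> refine ⟨?_, ?_, ?_, ?_⟩ <;> linarith

lemma card_erase_erase {j l : Fin N} (hjl : j < l) :
    (((univ.erase j).erase l).card : ℝ) = N - 2 := by
  rw [Finset.card_erase_of_mem (by simp [hjl.ne']), Finset.card_erase_of_mem (by simp)]
  simp only [Finset.card_univ, Fintype.card_fin]
  have : 2 ≤ N := by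
    have := j.2
    have := l.2
    have : (j : ℕ) < l := hjl
    omega
  rw [Nat.sub_sub, Nat.cast_sub this]
  norm_num

lemma pairMass_tail (hpos : ∀ i, 0 < p i) (hsum : ∑ i, p i = 1) {j l : Fin N} (hjl : j < l)
    (s : Str k K) {V H : ℝ} (hV : ∀ m : Fin N, precProb p s j m * (1 - precProb p s j m) ≤ V)
    (hNV : 1 ≤ N * V) (hs : N * strP p s ≤ √(N * V)) (i : ℕ) (hi : H ≤ |i - N * lexCdf p s|) :
    pairMass p j l s i ≤ strP p s ^ 2 * Real.exp (3 - H / √(N * V)) := by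
  set r := √(N * V) with hr
  have hr1 : 1 ≤ r := Real.one_le_sqrt.2 hNV
  have hr0 : 0 < r := by linarith
  have hr2 : r ^ 2 = N * V := Real.sq_sqrt (by linarith)
  have hV0 : 0 ≤ V := by
    have := precProb_mem hpos hsum s j j
    exact (mul_nonneg this.2.2.1 (sub_nonneg.2 this.2.2.2)).trans (hV j)
  have hF := lexCdf_nonneg hpos s
  have hF1 : lexCdf p s ≤ 1 := by
    linarith [lexCdf_add_strP_le_one hpos hsum s, strP_pos hpos s]
  have hcard := card_erase_erase hjl
  set I := (univ.erase j).erase l with hI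
  have hlo : (N - 2) * lexCdf p s ≤ ∑ m ∈ I, precProb p s j m := by
    rw [← hcard, ← nsmul_eq_mul]
    exact Finset.card_nsmul_le_sum _ _ _ fun m _ => (precProb_mem hpos hsum s j m).1
  have hhi : ∑ m ∈ I, precProb p s j m ≤ N * (lexCdf p s + strP p s) := by
    refine (Finset.sum_le_card_nsmul _ _ _ fun m _ => (precProb_mem hpos hsum s j m).2.1).trans ?_
    rw [nsmul_eq_mul, hcard]
    have := strP_pos hpos s
    gcongr
    linarith
  have main : ∀ u : ℝ, |u| = 1 / r → u * (∑ m ∈ I, precProb p s j m - i) ≤ 2 - H / r →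
      pairMass p j l s i ≤ strP p s ^ 2 * Real.exp (3 - H / r) := by
    intro u hu h
    have hu1 : |u| ≤ 1 := by rw [hu]; exact (div_le_one hr0).2 hr1
    have hu2 : u ^ 2 * (N * V) = 1 := by
      rw [← sq_abs, hu, ← hr2]
      field_simp
    refine (pairMass_le_exp hpos hsum hjl s i u).trans ?_
    refine mul_le_mul_of_nonneg_left ?_ (by positivity)
    calc Real.exp (-(u * i)) * ∏ m ∈ I, (1 + precProb p s j m * (Real.exp u - 1))
        ≤ Real.exp (-(u * i)) * ∏ m ∈ I, Real.exp (u * precProb p s j m + u ^ 2 * V) := by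
          refine mul_le_mul_of_nonneg_left (Finset.prod_le_prod (fun m _ => ?_) fun m _ => ?_)
            (Real.exp_pos _).le
          · have := (precProb_mem hpos hsum s j m).2.2
            nlinarith [Real.exp_pos u]
          · have := (precProb_mem hpos hsum s j m).2.2
            exact one_add_mul_exp_sub_one_le this.1 this.2 hu1 (hV m)
      _ = Real.exp (u * (∑ m ∈ I, precProb p s j m - i) + (N - 2) * (u ^ 2 * V)) := by
          rw [← Real.exp_sum, ← Real.exp_add, Finset.sum_add_distrib, Finset.sum_const,
            nsmul_eq_mul, hcard, ← Finset.mul_sum]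
          ring_nf
      _ ≤ Real.exp (3 - H / r) := by
          refine Real.exp_le_exp.2 ?_
          have : 0 ≤ u ^ 2 * V := by positivity
          linarith
  rcases le_abs'.1 hi with hi | hi
  · refine main (-(1 / r)) (by rw [abs_neg, abs_of_pos (by positivity)]) ?_
    have h1 : (i : ℝ) - ∑ m ∈ I, precProb p s j m ≤ 2 - H := by nlinarith
    have h2 : 2 / r ≤ 2 := (div_le_iff₀ hr0).2 (by linarith)
    calc -(1 / r) * (∑ m ∈ I, precProb p s j m - i)
        = (i - ∑ m ∈ I, precProb p s j m) / r := by ring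
      _ ≤ (2 - H) / r := by gcongr
      _ = 2 / r - H / r := by ring
      _ ≤ 2 - H / r := by linarith
  · refine main (1 / r) (abs_of_pos (by positivity)) ?_
    calc 1 / r * (∑ m ∈ I, precProb p s j m - i)
        = (∑ m ∈ I, precProb p s j m - i) / r := by ring
      _ ≤ (r - H) / r := div_le_div_of_nonneg_right (by linarith) hr0.le
      _ = 1 - H / r := by field_simp
      _ ≤ 2 - H / r := by linarith

lemma norm_one_add_mul_exp_le {x τ v : ℝ} (hv : v ≤ x * (1 - x)) (hv0 : 0 ≤ v)
    (hτ : |τ| ≤ Real.pi) :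
    ‖1 + (x : ℂ) * (Complex.exp (τ * Complex.I) - 1)‖ ≤
      Real.exp (-(v * (2 / Real.pi ^ 2) * τ ^ 2)) := by
  have h1 : ‖1 + (x : ℂ) * (Complex.exp (τ * Complex.I) - 1)‖ ^ 2 =
      1 + -(2 * (x * (1 - x)) * (1 - Real.cos τ)) := by
    rw [Complex.sq_norm, Complex.normSq_apply]
    simp only [Complex.add_re, Complex.add_im, Complex.mul_re, Complex.mul_im, Complex.sub_re,
      Complex.sub_im, Complex.exp_ofReal_mul_I_re, Complex.exp_ofReal_mul_I_im, Complex.one_re,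
      Complex.one_im, Complex.ofReal_re, Complex.ofReal_im]
    linear_combination x ^ 2 * Real.sin_sq_add_cos_sq τ
  have h2 := Real.cos_le_one_sub_mul_cos_sq hτ
  refine le_of_sq_le_sq ?_ (Real.exp_pos _).le
  rw [h1, ← Real.exp_nat_mul]
  rw [add_comm]
  refine (Real.add_one_le_exp _).trans (Real.exp_le_exp.2 ?_)
  have h3 : v * (2 / Real.pi ^ 2 * τ ^ 2) ≤ x * (1 - x) * (1 - Real.cos τ) :=
    mul_le_mul hv (by linarith) (by positivity) (hv0.trans hv)
  push_cast
  linarith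

lemma integral_exp_int_mul (n : ℤ) :
    ∫ τ in (-Real.pi)..Real.pi, Complex.exp (n * Complex.I * τ) =
      if n = 0 then (2 * Real.pi : ℂ) else 0 := by
  split_ifs with h
  · simp [h]
    ring
  · have hc : (n : ℂ) * Complex.I ≠ 0 := by simp [h]
    rw [integral_exp_mul_complex hc, div_eq_zero_iff]
    left
    rw [sub_eq_zero, Complex.exp_eq_exp_iff_exists_int]
    exact ⟨n, by push_cast; ring⟩

lemma two_pi_mul_pairMass (hsum : ∑ i, p i = 1) {j l : Fin N} (hjl : j < l) (s : Str k K)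
    (i : ℕ) :
    (2 * Real.pi * pairMass p j l s i : ℂ) = ∫ τ in (-Real.pi)..Real.pi,
      Complex.exp (-i * Complex.I * τ) * ((strP p s : ℂ) ^ 2 *
        ∏ m ∈ (univ.erase j).erase l,
          (1 + (precProb p s j m : ℂ) * (Complex.exp (τ * Complex.I) - 1))) := by
  have h1 : ∀ τ : ℝ, Complex.exp (-i * Complex.I * τ) * ((strP p s : ℂ) ^ 2 *
        ∏ m ∈ (univ.erase j).erase l,
          (1 + (precProb p s j m : ℂ) * (Complex.exp (τ * Complex.I) - 1))) =
      ∑ ω : Fin N → Str k K, (if ω j = s ∧ ω l = s then (seqP p ω : ℂ) else 0) *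
        Complex.exp (((rank ω s j - i : ℤ) : ℂ) * Complex.I * τ) := by
    intro τ
    have := sum_seqP_mul_pow_rank (𝕜 := ℂ) hsum hjl s (Complex.exp (τ * Complex.I))
    simp only [Complex.coe_algebraMap] at this
    rw [← this, Finset.mul_sum]
    refine Finset.sum_congr rfl fun ω _ => ?_
    split_ifs
    · rw [← Complex.exp_nat_mul, mul_left_comm, ← Complex.exp_add]
      congr 2
      push_cast
      ring
    · simp
  simp only [h1]
  rw [intervalIntegral.integral_finsetSum fun ω _ =>
    (Continuous.intervalIntegrable (by fun_prop) _ _)]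
  simp only [intervalIntegral.integral_const_mul, integral_exp_int_mul, pairMass]
  rw [Complex.ofReal_sum, Finset.mul_sum]
  refine Finset.sum_congr rfl fun ω _ => ?_
  by_cases h2 : ω j = s ∧ ω l = s
  · simp only [h2, true_and, and_self, if_true, sub_eq_zero, Nat.cast_inj]
    split_ifs
    · ring
    · simp
  · rw [if_neg h2, if_neg fun h => h2 ⟨h.1, h.2.1⟩]
    simp

lemma pairMass_le_div_sqrt (hsum : ∑ i, p i = 1) {j l : Fin N} (hjl : j < l)
    (s : Str k K) {c V : ℝ} (hc : 0 < c) (hVpos : 0 < V) (hN : 4 ≤ N)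
    (hV : ∀ m : Fin N, c * V ≤ precProb p s j m * (1 - precProb p s j m)) (i : ℕ) :
    pairMass p j l s i ≤ strP p s ^ 2 * (√(Real.pi ^ 3 / c) / √(N * V)) := by
  have hN' : (4 : ℝ) ≤ N := by exact_mod_cast hN
  have hpi := Real.pi_pos
  set b : ℝ := (N - 2) * (c * V * (2 / Real.pi ^ 2)) with hb
  have hN2 : (0 : ℝ) < N - 2 := by linarith
  have hb0 : 0 < b := by positivity
  have hbN : N * V * c / Real.pi ^ 2 ≤ b := by
    rw [hb, div_le_iff₀ (by positivity)]
    field_simp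
    linarith
  have hint : MeasureTheory.Integrable (fun τ : ℝ => strP p s ^ 2 * Real.exp (-b * τ ^ 2)) :=
    (integrable_exp_neg_mul_sq hb0).const_mul _
  have h1 : ‖(2 * Real.pi * pairMass p j l s i : ℂ)‖ ≤
      ∫ τ in (-Real.pi)..Real.pi, strP p s ^ 2 * Real.exp (-b * τ ^ 2) := by
    rw [two_pi_mul_pairMass hsum hjl]
    refine intervalIntegral.norm_integral_le_of_norm_le (by linarith)
      (Filter.Eventually.of_forall fun τ hτ => ?_) hint.intervalIntegrable
    have hτ' : |τ| ≤ Real.pi := abs_le.2 ⟨hτ.1.le, hτ.2⟩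
    have h2 : ‖Complex.exp (-i * Complex.I * τ)‖ = 1 := by
      rw [Complex.norm_exp]
      simp
    rw [norm_mul, h2, one_mul, norm_mul, norm_pow, Complex.norm_real, Real.norm_eq_abs, sq_abs,
      norm_prod]
    refine mul_le_mul_of_nonneg_left ?_ (sq_nonneg _)
    refine (Finset.prod_le_prod (fun m _ => norm_nonneg _) fun m _ =>
      norm_one_add_mul_exp_le (hV m) (by positivity) hτ').trans ?_
    rw [Finset.prod_const, ← Real.exp_nat_mul, card_erase_erase hjl, hb]
    apply le_of_eq
    ring_nf
  have h3 : ∫ τ in (-Real.pi)..Real.pi, strP p s ^ 2 * Real.exp (-b * τ ^ 2) ≤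
      strP p s ^ 2 * √(Real.pi / b) := by
    rw [← integral_gaussian, ← MeasureTheory.integral_const_mul,
      intervalIntegral.integral_of_le (by linarith)]
    exact MeasureTheory.setIntegral_le_integral hint
      (Filter.Eventually.of_forall fun τ => by positivity)
  have h4 : √(Real.pi / b) ≤ √(Real.pi ^ 3 / c) / √(N * V) := by
    rw [← Real.sqrt_div (by positivity)]
    refine Real.sqrt_le_sqrt ?_
    calc Real.pi / b ≤ Real.pi / (N * V * c / Real.pi ^ 2) := by gcongr
      _ = _ := by field_simp
  have h5 : pairMass p j l s i ≤ ‖(2 * Real.pi * pairMass p j l s i : ℂ)‖ := by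
    rw [show (2 * Real.pi * pairMass p j l s i : ℂ) = ((2 * Real.pi * pairMass p j l s i : ℝ) : ℂ)
      by push_cast; rfl, Complex.norm_real, Real.norm_eq_abs, abs_mul, abs_of_pos (by positivity)]
    have := le_abs_self (pairMass p j l s i)
    nlinarith [Real.pi_gt_three, abs_nonneg (pairMass p j l s i)]
  exact h5.trans (h1.trans (h3.trans (mul_le_mul_of_nonneg_left h4 (sq_nonneg _))))

end RankBounds

section Edges

variable {k K N : ℕ} {p : Fin k → ℝ}

/-- The pairs of indices in increasing order. -/
def orderedPairs (N : ℕ) : Finset (Fin N × Fin N) := univ.filter fun q => q.1 < q.2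

lemma card_orderedPairs_le (N : ℕ) : ((orderedPairs N).card : ℝ) ≤ (N : ℝ) ^ 2 := by
  have := Finset.card_filter_le (univ : Finset (Fin N × Fin N)) fun q => q.1 < q.2
  simp only [Finset.card_univ, Fintype.card_prod, Fintype.card_fin] at this
  rw [sq]
  exact_mod_cast this

/-- Upper bound for the probability that the edge at position `i` joins two copies of `s`. -/
noncomputable def edgeMass (N : ℕ) (p : Fin k → ℝ) (s : Str k K) (i : ℕ) : ℝ :=
  ∑ q ∈ orderedPairs N, pairMass p q.1 q.2 s i

lemma rank_sort (ω : Fin N → Str k K) (i : Fin N) :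
    rank ω (ω (Tuple.sort (fun j => lexVal (ω j)) i)) (Tuple.sort (fun j => lexVal (ω j)) i) =
      i := by
  set f : Fin N → ℕ := fun j => lexVal (ω j) with hf
  obtain ⟨h1, h2⟩ := (Tuple.eq_sort_iff (f := f)).1 rfl
  set σ := Tuple.sort f
  have h3 : (univ.filter fun m => Precedes (ω (σ i)) (σ i) m (ω m)) =
      (Finset.Iio i).map σ.toEmbedding := by
    ext m
    obtain ⟨a, rfl⟩ := σ.surjective m
    simp only [Finset.mem_filter, Finset.mem_univ, true_and, Finset.mem_map_equiv,
      Equiv.symm_apply_apply, Finset.mem_Iio]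
    constructor
    · intro h
      by_contra! hai
      rcases h with h | ⟨h, h'⟩
      · exact h.not_ge (h1 hai)
      · rcases hai.eq_or_lt with rfl | hai
        · exact h'.false
        · exact h'.not_gt (h2 _ _ hai (by simp [hf, h]))
    · intro hai
      rcases (h1 hai.le).lt_or_eq with h | h
      · exact Or.inl h
      · exact Or.inr ⟨lexVal_injective h, h2 _ _ hai h⟩
  rw [rank, h3, Finset.card_map, Fin.card_Iio]

lemma exists_pair_of_mem_edgeSet {ω : Fin N → Str k K} {e : Fin N × Fin N}
    (he : e ∈ edgeSet (sortedSeq ω)) :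
    ∃ s, ∃ q ∈ orderedPairs N, ω q.1 = s ∧ ω q.2 = s ∧ rank ω s q.1 = e.1 := by
  obtain ⟨h1, h2⟩ := (Finset.mem_filter.1 he).2
  simp only [sortedSeq] at h2
  set f : Fin N → ℕ := fun j => lexVal (ω j)
  refine ⟨ω (Tuple.sort f e.1), (Tuple.sort f e.1, Tuple.sort f e.2), ?_, rfl, h2.symm,
    rank_sort ω e.1⟩
  refine Finset.mem_filter.2 ⟨Finset.mem_univ _, ?_⟩
  refine ((Tuple.eq_sort_iff (f := f)).1 rfl).2 _ _ (show (e.1 : ℕ) < e.2 by omega) ?_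
  exact congrArg lexVal h2

lemma edge_prob_le (hpos : ∀ i, 0 < p i) (e : Fin N × Fin N) :
    ∑ ω : Fin N → Str k K, (if e ∈ edgeSet (sortedSeq ω) then seqP p ω else 0) ≤
      ∑ s : Str k K, edgeMass N p s e.1 := by
  simp only [edgeMass, pairMass]
  rw [Finset.sum_congr rfl fun s _ => Finset.sum_comm, Finset.sum_comm]
  refine Finset.sum_le_sum fun ω _ => ?_
  have h0 : ∀ (s : Str k K) (q : Fin N × Fin N),
      0 ≤ if ω q.1 = s ∧ ω q.2 = s ∧ rank ω s q.1 = e.1 then seqP p ω else 0 := fun s q => by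
    split_ifs <;> simp [seqP_nonneg hpos]
  split_ifs with he
  · obtain ⟨s, q, hq, h⟩ := exists_pair_of_mem_edgeSet he
    refine le_trans ?_ (Finset.single_le_sum (fun s _ => Finset.sum_nonneg fun q _ => h0 s q)
      (Finset.mem_univ s))
    refine le_trans ?_ (Finset.single_le_sum (fun q _ => h0 s q) hq)
    rw [if_pos h]
  · exact Finset.sum_nonneg fun s _ => Finset.sum_nonneg fun q _ => h0 s q

lemma edgeMass_nonneg (hpos : ∀ i, 0 < p i) (s : Str k K) (i : ℕ) : 0 ≤ edgeMass N p s i :=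
  Finset.sum_nonneg fun _ _ => pairMass_nonneg hpos _ _ _ _

lemma edgeMass_le (s : Str k K) (i : ℕ) {b : ℝ} (hb : 0 ≤ b)
    (h : ∀ j l : Fin N, j < l → pairMass p j l s i ≤ strP p s ^ 2 * b) :
    edgeMass N p s i ≤ N ^ 2 * (strP p s ^ 2 * b) := by
  refine (Finset.sum_le_card_nsmul _ _ (strP p s ^ 2 * b) fun q hq =>
    h _ _ (Finset.mem_filter.1 hq).2).trans ?_
  rw [nsmul_eq_mul]
  exact mul_le_mul_of_nonneg_right (card_orderedPairs_le N) (by positivity)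

lemma sum_edgeMass_le (hpos : ∀ i, 0 < p i) (hsum : ∑ i, p i = 1) (s : Str k K) (I : Finset ℕ) :
    ∑ i ∈ I, edgeMass N p s i ≤ N ^ 2 * strP p s ^ 2 := by
  simp only [edgeMass]
  rw [Finset.sum_comm]
  refine (Finset.sum_le_card_nsmul _ _ (strP p s ^ 2) fun q hq =>
    sum_pairMass_le hpos hsum (Finset.mem_filter.1 hq).2 s I).trans ?_
  rw [nsmul_eq_mul]
  exact mul_le_mul_of_nonneg_right (card_orderedPairs_le N) (by positivity)

lemma sum_shared_edges_eq :
    ∑ ω : Fin N → Str k K, ∑ ω' : Fin N → Str k K, seqP p ω * seqP p ω' *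
        ((edgeSet (sortedSeq ω) ∩ edgeSet (sortedSeq ω')).card : ℝ) =
      ∑ e : Fin N × Fin N,
        (∑ ω : Fin N → Str k K, if e ∈ edgeSet (sortedSeq ω) then seqP p ω else 0) ^ 2 := by
  simp only [sq, Finset.sum_mul_sum]
  rw [Finset.sum_comm (s := (univ : Finset (Fin N × Fin N)))]
  refine Finset.sum_congr rfl fun ω _ => ?_
  rw [Finset.sum_comm]
  refine Finset.sum_congr rfl fun ω' _ => ?_
  rw [← Finset.filter_univ_mem (edgeSet (sortedSeq ω) ∩ edgeSet (sortedSeq ω')), Finset.card_filter,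
    Nat.cast_sum, Finset.mul_sum]
  refine Finset.sum_congr rfl fun e _ => ?_
  by_cases h1 : e ∈ edgeSet (sortedSeq ω) <;> by_cases h2 : e ∈ edgeSet (sortedSeq ω') <;>
    simp [h1, h2]

lemma sum_shared_edges_le (hpos : ∀ i, 0 < p i) :
    ∑ ω : Fin N → Str k K, ∑ ω' : Fin N → Str k K, seqP p ω * seqP p ω' *
        ((edgeSet (sortedSeq ω) ∩ edgeSet (sortedSeq ω')).card : ℝ) ≤
      ∑ i ∈ Finset.range N, (∑ s : Str k K, edgeMass N p s i) ^ 2 := by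
  rw [sum_shared_edges_eq]
  let P : Fin N × Fin N → Prop := fun e => (e.2 : ℕ) = e.1 + 1
  have h0 : ∀ e : Fin N × Fin N, ¬ P e →
      (∑ ω : Fin N → Str k K, if e ∈ edgeSet (sortedSeq ω) then seqP p ω else 0) ^ 2 = 0 := by
    intro e he
    rw [sq_eq_zero_iff]
    exact Finset.sum_eq_zero fun ω _ => if_neg fun h => he (Finset.mem_filter.1 h).2.1
  have h1 : ∑ e : Fin N × Fin N,
        (∑ ω : Fin N → Str k K, if e ∈ edgeSet (sortedSeq ω) then seqP p ω else 0) ^ 2 =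
      ∑ e with P e,
        (∑ ω : Fin N → Str k K, if e ∈ edgeSet (sortedSeq ω) then seqP p ω else 0) ^ 2 :=
    (Finset.sum_filter_of_ne fun e _ he => by_contra fun h => he (h0 e h)).symm
  rw [h1]
  calc _ ≤ ∑ e with P e, (∑ s : Str k K, edgeMass N p s e.1) ^ 2 := by
        refine Finset.sum_le_sum fun e _ => pow_le_pow_left₀ ?_ (edge_prob_le hpos e) 2
        exact Finset.sum_nonneg fun ω _ => by split_ifs <;> simp [seqP_nonneg hpos]
    _ = ∑ i ∈ (univ.filter P).image (fun e => (e.1 : ℕ)),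
        (∑ s : Str k K, edgeMass N p s i) ^ 2 := by
        rw [Finset.sum_image]
        intro e he e' he' h
        simp only [P, Finset.coe_filter, Finset.mem_univ, true_and, Set.mem_ofPred_eq] at he he'
        refine Prod.ext (Fin.ext h) (Fin.ext ?_)
        simp only at h
        omega
    _ ≤ _ := by
        refine Finset.sum_le_sum_of_subset_of_nonneg ?_ fun _ _ _ => sq_nonneg _
        intro i hi
        obtain ⟨e, -, rfl⟩ := Finset.mem_image.1 hi
        exact Finset.mem_range.2 e.1.2

lemma sum_shared_edges_le_sq (hpos : ∀ i, 0 < p i) (hsum : ∑ i, p i = 1) :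
    ∑ ω : Fin N → Str k K, ∑ ω' : Fin N → Str k K, seqP p ω * seqP p ω' *
        ((edgeSet (sortedSeq ω) ∩ edgeSet (sortedSeq ω')).card : ℝ) ≤ (N : ℝ) ^ 2 := by
  rw [sum_shared_edges_eq]
  calc _ ≤ ∑ e : Fin N × Fin N, (1 : ℝ) := by
        refine Finset.sum_le_sum fun e _ => pow_le_one₀ ?_ ?_
        · exact Finset.sum_nonneg fun ω _ => by split_ifs <;> simp [seqP_nonneg hpos]
        · rw [← sum_seqP (N := N) (K := K) hsum]
          exact Finset.sum_le_sum fun ω _ => by split_ifs <;> simp [seqP_nonneg hpos]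
    _ = _ := by simp [sq]

end Edges

section SquareSums

lemma card_le_of_separated {X : Finset ℝ} {a b ℓ : ℝ} (hℓ : 0 < ℓ) (hab : a ≤ b)
    (hX : ∀ x ∈ X, a ≤ x ∧ x ≤ b) (hsep : ∀ x ∈ X, ∀ y ∈ X, x < y → x + ℓ ≤ y) :
    (X.card : ℝ) ≤ (b - a) / ℓ + 1 := by
  have h1 : X.card ≤ (Finset.range (⌊(b - a) / ℓ⌋₊ + 1)).card := by
    refine Finset.card_le_card_of_injOn (fun x => ⌊(x - a) / ℓ⌋₊) ?_ ?_
    · intro x hx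
      refine Finset.mem_coe.2 (Finset.mem_range.2 (Nat.lt_succ_of_le (Nat.floor_le_floor ?_)))
      have := (hX x hx).2
      gcongr
    · have key : ∀ x ∈ X, ∀ y ∈ X, x < y → ⌊(x - a) / ℓ⌋₊ < ⌊(y - a) / ℓ⌋₊ := by
        intro x hx y hy hxy
        have h2 : 0 ≤ (x - a) / ℓ := div_nonneg (sub_nonneg.2 (hX x hx).1) hℓ.le
        rw [← Nat.succ_le_iff, Nat.succ_eq_add_one, ← Nat.floor_add_one h2]
        refine Nat.floor_le_floor ?_
        rw [div_add_one hℓ.ne']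
        have := hsep x hx y hy hxy
        gcongr
        linarith
      intro x hx y hy hxy
      rcases lt_trichotomy x y with h | h | h
      · exact absurd hxy (key x hx y hy h).ne
      · exact h
      · exact absurd hxy (key y hy x hx h).ne'
  rw [Finset.card_range] at h1
  have h2 : ((⌊(b - a) / ℓ⌋₊ : ℕ) : ℝ) ≤ (b - a) / ℓ :=
    Nat.floor_le (div_nonneg (sub_nonneg.2 hab) hℓ.le)
  have h3 : (X.card : ℝ) ≤ ((⌊(b - a) / ℓ⌋₊ + 1 : ℕ) : ℝ) := by exact_mod_cast h1
  push_cast at h3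
  linarith

variable {ι : Type*}

/-- The map `α` sends the points of `T`, located by `F`, to the left endpoints of disjoint
intervals containing them, distinct left endpoints being at distance at least `ℓ`. -/
structure IsCellMap (T : Finset ι) (F α : ι → ℝ) (ℓ : ℝ) : Prop where
  le : ∀ s ∈ T, α s ≤ F s
  le_of_lt : ∀ s ∈ T, ∀ t ∈ T, α s < α t → F s ≤ α t
  sep : ∀ s ∈ T, ∀ t ∈ T, α s < α t → α s + ℓ ≤ α t

lemma IsCellMap.mono {T T' : Finset ι} {F α : ι → ℝ} {ℓ : ℝ} (h : IsCellMap T F α ℓ)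
    (hT : T' ⊆ T) : IsCellMap T' F α ℓ :=
  ⟨fun s hs => h.le s (hT hs), fun s hs t ht => h.le_of_lt s (hT hs) t (hT ht),
    fun s hs t ht => h.sep s (hT hs) t (hT ht)⟩

lemma IsCellMap.card_image_le {T : Finset ι} {F α : ι → ℝ} {ℓ a b : ℝ} (h : IsCellMap T F α ℓ)
    (hℓ : 0 < ℓ) (hab : a ≤ b) (hF : ∀ s ∈ T, a ≤ F s ∧ F s ≤ b) :
    ((T.image α).card : ℝ) ≤ (b - a) / ℓ + 2 := by
  have h1 : (((T.image α).filter (a ≤ ·)).card : ℝ) ≤ (b - a) / ℓ + 1 := by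
    refine card_le_of_separated hℓ hab ?_ ?_
    · intro x hx
      obtain ⟨hx, hax⟩ := Finset.mem_filter.1 hx
      obtain ⟨s, hs, rfl⟩ := Finset.mem_image.1 hx
      exact ⟨hax, (h.le s hs).trans (hF s hs).2⟩
    · intro x hx y hy
      obtain ⟨s, hs, rfl⟩ := Finset.mem_image.1 (Finset.mem_filter.1 hx).1
      obtain ⟨t, ht, rfl⟩ := Finset.mem_image.1 (Finset.mem_filter.1 hy).1
      exact h.sep s hs t ht
  have h2 : ((T.image α).filter (¬ a ≤ ·)).card ≤ 1 := by
    rw [Finset.card_le_one]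
    have key : ∀ s ∈ T, ∀ t ∈ T, ¬ a ≤ α t → ¬ α s < α t := fun s hs t ht hat hst =>
      hat ((hF s hs).1.trans (h.le_of_lt s hs t ht hst))
    intro x hx y hy
    obtain ⟨hx, hax⟩ := Finset.mem_filter.1 hx
    obtain ⟨hy, hay⟩ := Finset.mem_filter.1 hy
    obtain ⟨s, hs, rfl⟩ := Finset.mem_image.1 hx
    obtain ⟨t, ht, rfl⟩ := Finset.mem_image.1 hy
    exact le_antisymm (not_lt.1 (key t ht s hs hax)) (not_lt.1 (key s hs t ht hay))
  have h3 := Finset.card_filter_add_card_filter_not (s := T.image α) (a ≤ ·)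
  have h4 : (((T.image α).filter (¬ a ≤ ·)).card : ℝ) ≤ 1 := by exact_mod_cast h2
  rw [← h3]
  push_cast
  linarith

lemma sum_image_sq_fiber (T : Finset ι) (α w : ι → ℝ) :
    ∑ x ∈ T.image α, (∑ s ∈ T with α s = x, w s) ^ 2 =
      ∑ s ∈ T, ∑ t ∈ T, if α s = α t then w s * w t else 0 := by
  rw [← Finset.sum_fiberwise_of_maps_to (fun s hs => Finset.mem_image_of_mem α hs)]
  refine Finset.sum_congr rfl fun x _ => ?_
  rw [sq, Finset.sum_mul_sum]
  refine Finset.sum_congr rfl fun s hs => ?_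
  rw [Finset.sum_filter]
  refine Finset.sum_congr rfl fun t _ => ?_
  rw [(Finset.mem_filter.1 hs).2]
  simp only [eq_comm]

/-- Second-moment bound for a family of nonnegative functions on `range N`, the function of index
`s` having total mass at most `D * w s`, sup-norm at most `D * w s * M`, and being at most
`D * w s * η` away from `N * F s`. -/
lemma sum_sq_le_of_localized {T : Finset ι} {F α w : ι → ℝ} {B : ι → ℕ → ℝ} {N : ℕ}
    {ℓ H M η D : ℝ} (hN : 0 < N) (hcell : IsCellMap T F α ℓ) (hℓ : 0 < ℓ) (hH : 0 ≤ H)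
    (hM : 0 ≤ M) (hη : 0 ≤ η) (hD : 0 ≤ D) (hw : ∀ s, 0 ≤ w s) (hw1 : ∑ s ∈ T, w s ≤ 1)
    (hB : ∀ s i, 0 ≤ B s i) (hBM : ∀ s ∈ T, ∀ i, B s i ≤ D * (w s * M))
    (hBη : ∀ s ∈ T, ∀ i : ℕ, H ≤ |i - N * F s| → B s i ≤ D * (w s * η))
    (hBsum : ∀ s ∈ T, ∑ i ∈ range N, B s i ≤ D * w s) :
    ∑ i ∈ range N, (∑ s ∈ T, B s i) ^ 2 ≤
      2 * ((2 * H / (N * ℓ) + 2) * (D ^ 2 * M *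
        ∑ s ∈ T, ∑ t ∈ T, if α s = α t then w s * w t else 0)) + 2 * (N * (D * η) ^ 2) := by
  have hN' : (0 : ℝ) < N := by exact_mod_cast hN
  set Q := 2 * H / (N * ℓ) + 2 with hQ
  have hQ0 : 0 ≤ Q := by positivity
  have hpoint : ∀ i : ℕ, (∑ s ∈ T, B s i) ^ 2 ≤
      2 * (Q * ∑ x ∈ T.image α, (∑ s ∈ T with α s = x, B s i) ^ 2) + 2 * (D * η) ^ 2 := by
    intro i
    set U := T.filter fun s => |i - N * F s| < H with hU
    have h1 : ∑ s ∈ T, B s i = ∑ s ∈ U, B s i + ∑ s ∈ T with ¬ |i - N * F s| < H, B s i :=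
      (Finset.sum_filter_add_sum_filter_not _ _ _).symm
    have h2 : ∑ s ∈ T with ¬ |i - N * F s| < H, B s i ≤ D * η := by
      calc _ ≤ ∑ s ∈ T with ¬ |i - N * F s| < H, D * (w s * η) :=
            Finset.sum_le_sum fun s hs => hBη s (Finset.mem_filter.1 hs).1 i
              (not_lt.1 (Finset.mem_filter.1 hs).2)
        _ ≤ ∑ s ∈ T, D * (w s * η) :=
            Finset.sum_le_sum_of_subset_of_nonneg (Finset.filter_subset _ _) fun s _ _ =>
              mul_nonneg hD (mul_nonneg (hw s) hη)
        _ = D * η * ∑ s ∈ T, w s := by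
            rw [Finset.mul_sum]
            exact Finset.sum_congr rfl fun s _ => by ring
        _ ≤ D * η * 1 := by gcongr
        _ = D * η := mul_one _
    have h20 : 0 ≤ ∑ s ∈ T with ¬ |i - N * F s| < H, B s i := Finset.sum_nonneg fun s _ => hB s i
    have h3 : (∑ s ∈ U, B s i) ^ 2 ≤
        Q * ∑ x ∈ T.image α, (∑ s ∈ T with α s = x, B s i) ^ 2 := by
      rw [← Finset.sum_fiberwise_of_maps_to (fun s hs => Finset.mem_image_of_mem α hs)]
      refine sq_sum_le_card_mul_sum_sq.trans (mul_le_mul ?_ ?_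
        (Finset.sum_nonneg fun _ _ => sq_nonneg _) hQ0)
      · have h4 := (hcell.mono (Finset.filter_subset _ T : U ⊆ T)).card_image_le
          (a := (i - H) / N) (b := (i + H) / N) hℓ (by gcongr; linarith) ?_
        · refine h4.trans (le_of_eq ?_)
          rw [hQ]
          congr 1
          field_simp
          ring
        · intro s hs
          have h5 := abs_lt.1 (Finset.mem_filter.1 hs).2
          rw [div_le_iff₀ hN', le_div_iff₀ hN']
          constructor <;> linarith
      · calc _ ≤ ∑ x ∈ U.image α, (∑ s ∈ T with α s = x, B s i) ^ 2 := by
              refine Finset.sum_le_sum fun x _ => pow_le_pow_left₀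
                (Finset.sum_nonneg fun s _ => hB s i) ?_ 2
              exact Finset.sum_le_sum_of_subset_of_nonneg
                (Finset.filter_subset_filter _ (Finset.filter_subset _ _)) fun s _ _ => hB s i
          _ ≤ _ := Finset.sum_le_sum_of_subset_of_nonneg
              (Finset.image_subset_image (Finset.filter_subset _ _)) fun _ _ _ => sq_nonneg _
    rw [h1]
    have h6 := pow_le_pow_left₀ h20 h2 2
    have h7 := add_sq_le (a := ∑ s ∈ U, B s i) (b := ∑ s ∈ T with ¬ |i - N * F s| < H, B s i)
    linarith
  have hcells : ∀ x, ∑ i ∈ range N, (∑ s ∈ T with α s = x, B s i) ^ 2 ≤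
      D ^ 2 * M * (∑ s ∈ T with α s = x, w s) ^ 2 := by
    intro x
    set W := ∑ s ∈ T with α s = x, w s
    have hW : 0 ≤ W := Finset.sum_nonneg fun s _ => hw s
    calc _ ≤ ∑ i ∈ range N, D * M * W * ∑ s ∈ T with α s = x, B s i := by
          refine Finset.sum_le_sum fun i _ => ?_
          rw [sq]
          refine mul_le_mul_of_nonneg_right ?_ (Finset.sum_nonneg fun s _ => hB s i)
          rw [Finset.mul_sum]
          refine Finset.sum_le_sum fun s hs => (hBM s (Finset.mem_filter.1 hs).1 i).trans ?_
          exact le_of_eq (by ring)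
      _ = D * M * W * ∑ s ∈ T with α s = x, ∑ i ∈ range N, B s i := by
          rw [← Finset.mul_sum, Finset.sum_comm]
      _ ≤ D * M * W * ∑ s ∈ T with α s = x, D * w s := by
          refine mul_le_mul_of_nonneg_left ?_ (by positivity)
          exact Finset.sum_le_sum fun s hs => hBsum s (Finset.mem_filter.1 hs).1
      _ = D ^ 2 * M * W ^ 2 := by
          rw [← Finset.mul_sum]
          ring
  calc _ ≤ ∑ i ∈ range N, (2 * (Q * ∑ x ∈ T.image α, (∑ s ∈ T with α s = x, B s i) ^ 2) +
          2 * (D * η) ^ 2) := Finset.sum_le_sum fun i _ => hpoint i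
    _ = 2 * (Q * ∑ x ∈ T.image α, ∑ i ∈ range N, (∑ s ∈ T with α s = x, B s i) ^ 2) +
          2 * (N * (D * η) ^ 2) := by
        rw [Finset.sum_add_distrib, ← Finset.mul_sum, ← Finset.mul_sum, Finset.sum_comm]
        simp
        ring
    _ ≤ 2 * (Q * ∑ x ∈ T.image α, D ^ 2 * M * (∑ s ∈ T with α s = x, w s) ^ 2) +
          2 * (N * (D * η) ^ 2) := by
        gcongr
        exact hcells _
    _ = _ := by rw [← Finset.mul_sum, sum_image_sq_fiber]

end SquareSums

section Cells

variable {k K : ℕ} {p : Fin k → ℝ}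

/-- The probability of the letters smaller than `i`. -/
noncomputable def letterCdf (p : Fin k → ℝ) (i : Fin k) : ℝ := ∑ j with j < i, p j

lemma letterCdf_nonneg (hpos : ∀ i, 0 < p i) (i : Fin k) : 0 ≤ letterCdf p i :=
  Finset.sum_nonneg fun j _ => (hpos j).le

lemma letterCdf_add_eq (i : Fin k) : letterCdf p i + p i = ∑ j with j ≤ i, p j := by
  have h : (univ.filter fun j => j ≤ i) = insert i (univ.filter fun j => j < i) := by
    ext j
    simp [le_iff_lt_or_eq, or_comm]
  rw [h, Finset.sum_insert (by simp), letterCdf, add_comm]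

lemma letterCdf_add_le (hpos : ∀ i, 0 < p i) {i j : Fin k} (h : i < j) :
    letterCdf p i + p i ≤ letterCdf p j := by
  rw [letterCdf_add_eq]
  refine Finset.sum_le_sum_of_subset_of_nonneg (fun a ha => ?_) fun j _ _ => (hpos j).le
  simp only [Finset.mem_filter, Finset.mem_univ, true_and] at ha ⊢
  exact ha.trans_lt h

lemma letterCdf_add_le_one (hpos : ∀ i, 0 < p i) (hsum : ∑ i, p i = 1) (i : Fin k) :
    letterCdf p i + p i ≤ 1 := by
  rw [letterCdf_add_eq, ← hsum]
  exact Finset.sum_le_sum_of_subset_of_nonneg (Finset.filter_subset _ _) fun j _ _ => (hpos j).le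

lemma le_letterCdf (hpos : ∀ i, 0 < p i) {i j : Fin k} (h : i < j) : p i ≤ letterCdf p j := by
  linarith [letterCdf_add_le hpos h, letterCdf_nonneg hpos i]

lemma lexCdf_cons' (hsum : ∑ i, p i = 1) (a : Fin k) (s : Str k K) :
    lexCdf p (Fin.cons a s : Str k (K + 1)) = letterCdf p a + p a * lexCdf p s :=
  lexCdf_cons p (sum_strP hsum) a s

lemma exists_cellMap_of_le (hpos : ∀ i, 0 < p i) {b g θ : ℝ} (hb : 0 < b)
    (hg : ∑ i, p i ^ 2 = g) (hθ4 : θ ≤ 4) (K : ℕ) {ℓ : ℝ} (hℓ1 : ℓ ≤ 1) (hbℓ : b ≤ ℓ) :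
    ∃ α : Str k K → ℝ, (∀ s, 0 ≤ α s ∧ α s + ℓ ≤ 1) ∧ IsCellMap univ (lexCdf p) α ℓ ∧
      ∑ s, ∑ t, (if α s = α t then strP p s ^ 2 * strP p t ^ 2 else 0) ≤
        (ℓ / b) ^ (4 - θ) * g ^ (2 * K) := by
  refine ⟨fun _ => 0, fun s => ⟨le_rfl, by linarith⟩, ⟨fun s _ => lexCdf_nonneg hpos s,
    fun s _ t _ h => absurd h (lt_irrefl _), fun s _ t _ h => absurd h (lt_irrefl _)⟩, ?_⟩
  simp only [if_true]
  rw [← Finset.sum_mul_sum, sum_strP_sq, hg, mul_comm 2, pow_mul, ← sq]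
  refine le_mul_of_one_le_left (by positivity) (Real.one_le_rpow ?_ (by linarith))
  exact (one_le_div hb).2 hbℓ

/-- Cutting the strings at the first initial word of probability about `ℓ / b` yields cells of
length at least `ℓ`, whose squared masses for the weight `strP p s ^ 2` have a controlled sum. -/
lemma exists_cellMap (hpos : ∀ i, 0 < p i) (hsum : ∑ i, p i = 1) {a b g θ : ℝ} (hb : 0 < b)
    (hb1 : b ≤ 1) (hbp : ∀ i, b ≤ p i) (ha : ∀ i, p i ≤ a) (hg : ∑ i, p i ^ 2 = g)
    (hθ : ∑ i, p i ^ θ = g ^ 2) (hθ4 : θ ≤ 4) (K : ℕ) {ℓ : ℝ} (hℓ : 0 < ℓ) (hℓ1 : ℓ ≤ 1)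
    (haℓ : a ^ K ≤ ℓ) :
    ∃ α : Str k K → ℝ, (∀ s, 0 ≤ α s ∧ α s + ℓ ≤ 1) ∧ IsCellMap univ (lexCdf p) α ℓ ∧
      ∑ s, ∑ t, (if α s = α t then strP p s ^ 2 * strP p t ^ 2 else 0) ≤
        (ℓ / b) ^ (4 - θ) * g ^ (2 * K) := by
  by_cases hbℓ : b ≤ ℓ
  · exact exists_cellMap_of_le hpos hb hg hθ4 K hℓ1 hbℓ
  induction K generalizing ℓ with
  | zero =>
    rw [pow_zero] at haℓ
    linarith
  | succ K ih =>
    push Not at hbℓ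
    have hex : ∀ i, ∃ α : Str k K → ℝ, (∀ s, 0 ≤ α s ∧ α s + ℓ / p i ≤ 1) ∧
        IsCellMap univ (lexCdf p) α (ℓ / p i) ∧
        ∑ s, ∑ t, (if α s = α t then strP p s ^ 2 * strP p t ^ 2 else 0) ≤
          (ℓ / p i / b) ^ (4 - θ) * g ^ (2 * K) := by
      intro i
      have hℓi : ℓ / p i ≤ 1 := (div_le_one (hpos i)).2 (hbℓ.le.trans (hbp i))
      by_cases h : b ≤ ℓ / p i
      · exact exists_cellMap_of_le hpos hb hg hθ4 K hℓi h
      · refine ih (div_pos hℓ (hpos i)) hℓi ?_ h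
        rw [le_div_iff₀ (hpos i)]
        refine le_trans ?_ haℓ
        rw [pow_succ]
        exact mul_le_mul_of_nonneg_left (ha i) (pow_nonneg ((hpos i).le.trans (ha i)) _)
    choose α h01 hcell hsumα using hex
    let β : Str k (K + 1) → ℝ := fun s => letterCdf p (s 0) + p (s 0) * α (s 0) (Fin.tail s)
    have hβ : ∀ i (s : Str k K), β (Fin.cons i s : Str k (K + 1)) =
        letterCdf p i + p i * α i s := fun i s => by simp [β]
    have hlo : ∀ i (s : Str k K), letterCdf p i ≤ β (Fin.cons i s : Str k (K + 1)) := fun i s => by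
      have := mul_nonneg (hpos i).le (h01 i s).1
      rw [hβ]
      linarith
    have hhi : ∀ i (s : Str k K), β (Fin.cons i s : Str k (K + 1)) + ℓ ≤
        letterCdf p i + p i := fun i s => by
      have := mul_le_mul_of_nonneg_left (h01 i s).2 (hpos i).le
      rw [mul_add, mul_div_cancel₀ _ (hpos i).ne'] at this
      rw [hβ]
      linarith
    have hF : ∀ i (s : Str k K), lexCdf p (Fin.cons i s : Str k (K + 1)) ≤
        letterCdf p i + p i := fun i s => by
      rw [lexCdf_cons' hsum]
      have h1 := lexCdf_add_strP_le_one hpos hsum s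
      have h2 := strP_pos hpos s
      nlinarith [hpos i]
    have hlt : ∀ i j (s t : Str k K), β (Fin.cons i s : Str k (K + 1)) <
        β (Fin.cons j t : Str k (K + 1)) → i < j ∨ i = j ∧ α i s < α i t := by
      intro i j s t h
      rcases lt_trichotomy i j with hij | rfl | hij
      · exact Or.inl hij
      · rw [hβ, hβ] at h
        exact Or.inr ⟨rfl, lt_of_mul_lt_mul_left (by linarith) (hpos i).le⟩
      · linarith [hhi j t, hlo i s, letterCdf_add_le hpos hij]
    refine ⟨β, ?_, ⟨?_, ?_, ?_⟩, ?_⟩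
    · intro s
      rw [← Fin.cons_self_tail s]
      exact ⟨(letterCdf_nonneg hpos _).trans (hlo _ _),
        (hhi _ _).trans (letterCdf_add_le_one hpos hsum _)⟩
    · intro s _
      rw [← Fin.cons_self_tail s, hβ, lexCdf_cons' hsum]
      have := mul_le_mul_of_nonneg_left ((hcell (s 0)).le (Fin.tail s) (Finset.mem_univ _))
        (hpos (s 0)).le
      linarith
    · intro s _ t _ h
      rw [← Fin.cons_self_tail s, ← Fin.cons_self_tail t] at h ⊢
      rcases hlt _ _ _ _ h with h1 | ⟨h1, h2⟩
      · exact (hF _ _).trans ((letterCdf_add_le hpos h1).trans (hlo _ _))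
      · rw [← h1, hβ, lexCdf_cons' hsum]
        have := mul_le_mul_of_nonneg_left ((hcell (s 0)).le_of_lt _ (Finset.mem_univ _) _
          (Finset.mem_univ _) h2) (hpos (s 0)).le
        linarith
    · intro s _ t _ h
      rw [← Fin.cons_self_tail s, ← Fin.cons_self_tail t] at h ⊢
      rcases hlt _ _ _ _ h with h1 | ⟨h1, h2⟩
      · exact (hhi _ _).trans ((letterCdf_add_le hpos h1).trans (hlo _ _))
      · rw [← h1, hβ, hβ]
        have := mul_le_mul_of_nonneg_left ((hcell (s 0)).sep _ (Finset.mem_univ _) _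
          (Finset.mem_univ _) h2) (hpos (s 0)).le
        rw [mul_add, mul_div_cancel₀ _ (hpos (s 0)).ne'] at this
        linarith
    · have heq : ∀ i (s : Str k K), ∑ j, ∑ t : Str k K,
          (if β (Fin.cons i s : Str k (K + 1)) = β (Fin.cons j t : Str k (K + 1)) then
            strP p (Fin.cons i s : Str k (K + 1)) ^ 2 * strP p (Fin.cons j t : Str k (K + 1)) ^ 2
            else 0) =
          p i ^ 4 * ∑ t, (if α i s = α i t then strP p s ^ 2 * strP p t ^ 2 else 0) := by
        intro i s
        rw [Finset.sum_eq_single i]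
        · rw [Finset.mul_sum]
          refine Finset.sum_congr rfl fun t _ => ?_
          simp only [hβ, add_right_inj, mul_right_inj' (hpos i).ne', strP_cons]
          split_ifs <;> ring
        · intro j _ hj
          refine Finset.sum_eq_zero fun t _ => if_neg fun h => ?_
          rcases lt_or_gt_of_ne hj with h1 | h1
          · linarith [hhi j t, hlo i s, letterCdf_add_le hpos h1]
          · linarith [hhi i s, hlo j t, letterCdf_add_le hpos h1]
        · exact fun h => absurd (Finset.mem_univ i) h
      calc _ = ∑ i, p i ^ 4 * ∑ s, ∑ t,
            (if α i s = α i t then strP p s ^ 2 * strP p t ^ 2 else 0) := by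
            rw [sum_str_succ]
            refine Finset.sum_congr rfl fun i _ => ?_
            rw [Finset.mul_sum]
            refine Finset.sum_congr rfl fun s _ => ?_
            rw [sum_str_succ, heq]
        _ ≤ ∑ i, p i ^ 4 * ((ℓ / p i / b) ^ (4 - θ) * g ^ (2 * K)) :=
            Finset.sum_le_sum fun i _ =>
              mul_le_mul_of_nonneg_left (hsumα i) (pow_nonneg (hpos i).le 4)
        _ = ∑ i, p i ^ θ * ((ℓ / b) ^ (4 - θ) * g ^ (2 * K)) := by
            refine Finset.sum_congr rfl fun i _ => ?_
            have h1 : p i ^ 4 = p i ^ θ * p i ^ (4 - θ) := by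
              rw [← Real.rpow_add (hpos i), add_sub_cancel]
              norm_cast
            rw [div_right_comm, Real.div_rpow (by positivity) (hpos i).le, h1]
            have := (Real.rpow_pos_of_pos (hpos i) (4 - θ)).ne'
            field_simp
        _ = _ := by
            rw [← Finset.sum_mul, hθ]
            ring

end Cells

section Prefixes

variable {k K : ℕ} {p : Fin k → ℝ}

/-- The strings whose first `m` letters are equal to `e`. -/
def prefixed (K : ℕ) (e : Fin k) (m : ℕ) : Finset (Str k K) :=
  univ.filter fun s => ∀ j : Fin K, (j : ℕ) < m → s j = e

lemma prefixed_zero (e : Fin k) : prefixed K e 0 = univ := by simp [prefixed]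

lemma cons_mem_prefixed {e a : Fin k} {m : ℕ} {s : Str k K} :
    (Fin.cons a s : Str k (K + 1)) ∈ prefixed (K + 1) e (m + 1) ↔
      a = e ∧ s ∈ prefixed K e m := by
  simp [prefixed, Fin.forall_fin_succ]

lemma prefixed_anti (e : Fin k) {m m' : ℕ} (h : m ≤ m') : prefixed K e m' ⊆ prefixed K e m := by
  intro s hs
  simp only [prefixed, Finset.mem_filter, Finset.mem_univ, true_and] at hs ⊢
  exact fun j hj => hs j (hj.trans_le h)

lemma sum_prefixed_succ {M : Type*} [AddCommMonoid M] (e : Fin k) (m : ℕ)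
    (f : Str k (K + 1) → M) :
    ∑ s ∈ prefixed (K + 1) e (m + 1), f s =
      ∑ s ∈ prefixed K e m, f (Fin.cons e s : Str k (K + 1)) := by
  rw [prefixed, Finset.sum_filter, sum_str_succ, Finset.sum_eq_single e]
  · rw [prefixed, Finset.sum_filter]
    refine Finset.sum_congr rfl fun s _ => ?_
    simp [Fin.forall_fin_succ]
  · intro a _ ha
    refine Finset.sum_eq_zero fun s _ => if_neg fun h => ha ?_
    exact h 0 (Nat.succ_pos m)
  · exact fun h => absurd (Finset.mem_univ e) h

lemma sum_prefixed_strP_sq (e : Fin k) (n m : ℕ) :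
    ∑ s ∈ prefixed (n + m) e m, strP p s ^ 2 = (p e ^ m) ^ 2 * (∑ i, p i ^ 2) ^ n := by
  induction m with
  | zero => simpa [prefixed_zero] using sum_strP_sq
  | succ m ih =>
    have := sum_prefixed_succ (K := n + m) e m fun s => strP p s ^ 2
    simp only [strP_cons, mul_pow, ← Finset.mul_sum, ih] at this
    exact this.trans (by ring)

lemma strP_le_pow (hpos : ∀ i, 0 < p i) {a : ℝ} (ha : ∀ i, p i ≤ a) (s : Str k K) :
    strP p s ≤ a ^ K := by
  simpa [strP] using Finset.prod_le_prod (s := univ) (fun j _ => (hpos (s j)).le)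
    fun j _ => ha (s j)

lemma strP_le_of_mem_prefixed (hpos : ∀ i, 0 < p i) {a : ℝ} (ha : ∀ i, p i ≤ a) {e : Fin k}
    {n m : ℕ} {s : Str k (n + m)} (hs : s ∈ prefixed (n + m) e m) :
    strP p s ≤ p e ^ m * a ^ n := by
  induction m with
  | zero => simpa using strP_le_pow hpos ha s
  | succ m ih =>
    obtain ⟨c, t, rfl⟩ : ∃ c t, s = (Fin.cons c t : Str k (n + m + 1)) :=
      ⟨_, _, (Fin.cons_self_tail s).symm⟩
    obtain ⟨rfl, ht⟩ := cons_mem_prefixed.1 hs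
    have := mul_le_mul_of_nonneg_left (ih ht) (hpos c).le
    refine (strP_cons p c t).trans_le (this.trans_eq (by ring))

lemma exists_cellMap_prefixed (hpos : ∀ i, 0 < p i) (hsum : ∑ i, p i = 1) (e : Fin k)
    {n : ℕ} {ℓ B : ℝ}
    (h : ∃ α : Str k n → ℝ, IsCellMap univ (lexCdf p) α ℓ ∧
      ∑ s, ∑ t, (if α s = α t then strP p s ^ 2 * strP p t ^ 2 else 0) ≤ B) (m : ℕ) :
    ∃ α : Str k (n + m) → ℝ, IsCellMap (prefixed (n + m) e m) (lexCdf p) α (p e ^ m * ℓ) ∧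
      ∑ s ∈ prefixed (n + m) e m, ∑ t ∈ prefixed (n + m) e m,
        (if α s = α t then strP p s ^ 2 * strP p t ^ 2 else 0) ≤ (p e ^ m) ^ 4 * B := by
  induction m with
  | zero => simpa [prefixed_zero] using h
  | succ m ih =>
    obtain ⟨α, hα, hB⟩ := ih
    have hcons : ∀ s ∈ prefixed (n + m + 1) e (m + 1), ∃ t ∈ prefixed (n + m) e m,
        s = (Fin.cons e t : Str k (n + m + 1)) := by
      intro s hs
      rw [← Fin.cons_self_tail s, cons_mem_prefixed] at hs
      refine ⟨_, hs.2, ?_⟩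
      rw [← hs.1, Fin.cons_self_tail]
    have he := hpos e
    have hlt : ∀ s t : Str k (n + m), letterCdf p e + p e * α s < letterCdf p e + p e * α t →
        α s < α t := fun s t h => lt_of_mul_lt_mul_left (by linarith) he.le
    refine ⟨fun s : Str k (n + m + 1) => letterCdf p e + p e * α (Fin.tail s), ⟨?_, ?_, ?_⟩, ?_⟩
    · intro s hs
      obtain ⟨s, hs', rfl⟩ := hcons s hs
      have := mul_le_mul_of_nonneg_left (hα.le s hs') he.le
      have h2 := lexCdf_cons' hsum e s
      simp only [Fin.tail_cons]
      refine le_trans ?_ h2.ge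
      linarith
    · intro s hs t ht h
      obtain ⟨s, hs', rfl⟩ := hcons s hs
      obtain ⟨t, ht', rfl⟩ := hcons t ht
      simp only [Fin.tail_cons] at h ⊢
      have := mul_le_mul_of_nonneg_left (hα.le_of_lt s hs' t ht' (hlt s t h)) he.le
      refine (lexCdf_cons' hsum e s).trans_le ?_
      linarith
    · intro s hs t ht h
      obtain ⟨s, hs', rfl⟩ := hcons s hs
      obtain ⟨t, ht', rfl⟩ := hcons t ht
      simp only [Fin.tail_cons] at h ⊢
      have := mul_le_mul_of_nonneg_left (hα.sep s hs' t ht' (hlt s t h)) he.le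
      rw [pow_succ]
      linarith
    · have h1 : ∀ s t : Str k (n + m),
          (if letterCdf p e + p e * α s = letterCdf p e + p e * α t then
          strP p (Fin.cons e s : Str k (n + m + 1)) ^ 2 *
            strP p (Fin.cons e t : Str k (n + m + 1)) ^ 2 else 0) =
          p e ^ 4 * if α s = α t then strP p s ^ 2 * strP p t ^ 2 else 0 := fun s t => by
        simp only [add_right_inj, mul_right_inj' he.ne', strP_cons]
        split_ifs <;> ring
      calc _ = ∑ s ∈ prefixed (n + m) e m, ∑ t ∈ prefixed (n + m) e m,
            p e ^ 4 * (if α s = α t then strP p s ^ 2 * strP p t ^ 2 else 0) :=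
            (sum_prefixed_succ (K := n + m) e m _).trans <| Finset.sum_congr rfl fun s _ =>
              (sum_prefixed_succ (K := n + m) e m _).trans <| Finset.sum_congr rfl fun t _ => h1 s t
        _ ≤ p e ^ 4 * ((p e ^ m) ^ 4 * B) := by
            simp only [← Finset.mul_sum]
            gcongr
        _ = _ := by ring

lemma lexCdf_add_strP_le_of_mem_prefixed (hpos : ∀ i, 0 < p i) (hsum : ∑ i, p i = 1) {e : Fin k}
    (he : ∀ i, e ≤ i) {m : ℕ} {s : Str k K} (hm : m ≤ K) (hs : s ∈ prefixed K e m) :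
    lexCdf p s + strP p s ≤ p e ^ m := by
  induction m generalizing K with
  | zero => simpa using lexCdf_add_strP_le_one hpos hsum s
  | succ m ih =>
    obtain ⟨K, rfl⟩ := Nat.exists_eq_add_one_of_ne_zero (show K ≠ 0 by omega)
    obtain ⟨c, t, rfl⟩ : ∃ c t, s = (Fin.cons c t : Str k (K + 1)) :=
      ⟨_, _, (Fin.cons_self_tail s).symm⟩
    obtain ⟨rfl, ht⟩ := cons_mem_prefixed.1 hs
    have h0 : letterCdf p c = 0 := Finset.sum_eq_zero fun j hj =>
      absurd (Finset.mem_filter.1 hj).2 (he j).not_gt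
    have := mul_le_mul_of_nonneg_left (ih (by omega) ht) (hpos c).le
    rw [lexCdf_cons' hsum, strP_cons, h0, pow_succ]
    linarith

lemma pow_le_lexCdf_of_notMem_prefixed (hpos : ∀ i, 0 < p i) (hsum : ∑ i, p i = 1) {e : Fin k}
    (he : ∀ i, e ≤ i) {m : ℕ} {s : Str k K} (hs : s ∉ prefixed K e m) :
    p e ^ m ≤ lexCdf p s := by
  have he1 : p e ≤ 1 := by linarith [letterCdf_add_le_one hpos hsum e, letterCdf_nonneg hpos e]
  induction m generalizing K with
  | zero => simp [prefixed_zero] at hs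
  | succ m ih =>
    rcases K with _ | K
    · exact absurd (Finset.mem_filter.2 ⟨Finset.mem_univ _, fun j => j.elim0⟩) hs
    obtain ⟨c, t, rfl⟩ : ∃ c t, s = (Fin.cons c t : Str k (K + 1)) :=
      ⟨_, _, (Fin.cons_self_tail s).symm⟩
    rw [lexCdf_cons' hsum, pow_succ']
    have hF := lexCdf_nonneg hpos t
    by_cases hc : c = e
    · subst hc
      have := mul_le_mul_of_nonneg_left (ih fun h => hs (cons_mem_prefixed.2 ⟨rfl, h⟩)) (hpos c).le
      linarith [letterCdf_nonneg hpos c]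
    · have h1 := le_letterCdf hpos (lt_of_le_of_ne (he c) (Ne.symm hc))
      have h2 := mul_le_of_le_one_right (hpos e).le (pow_le_one₀ (n := m) (hpos e).le he1)
      have h3 := mul_nonneg (hpos c).le hF
      linarith

lemma letterCdf_add_eq_one (hsum : ∑ i, p i = 1) {e : Fin k} (he : ∀ i, i ≤ e) :
    letterCdf p e + p e = 1 := by
  rw [letterCdf_add_eq, ← hsum]
  exact Finset.sum_congr (Finset.filter_true_of_mem fun i _ => he i) fun _ _ => rfl

lemma one_sub_pow_le_lexCdf_of_mem_prefixed (hpos : ∀ i, 0 < p i) (hsum : ∑ i, p i = 1)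
    {e : Fin k} (he : ∀ i, i ≤ e) {m : ℕ} {s : Str k K} (hm : m ≤ K) (hs : s ∈ prefixed K e m) :
    1 - p e ^ m ≤ lexCdf p s := by
  induction m generalizing K with
  | zero => simpa using lexCdf_nonneg hpos s
  | succ m ih =>
    obtain ⟨K, rfl⟩ := Nat.exists_eq_add_one_of_ne_zero (show K ≠ 0 by omega)
    obtain ⟨c, t, rfl⟩ : ∃ c t, s = (Fin.cons c t : Str k (K + 1)) :=
      ⟨_, _, (Fin.cons_self_tail s).symm⟩
    obtain ⟨rfl, ht⟩ := cons_mem_prefixed.1 hs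
    have := mul_le_mul_of_nonneg_left (ih (by omega) ht) (hpos c).le
    rw [lexCdf_cons' hsum, pow_succ]
    linarith [letterCdf_add_eq_one hsum he]

lemma lexCdf_add_strP_le_of_notMem_prefixed (hpos : ∀ i, 0 < p i) (hsum : ∑ i, p i = 1)
    {e : Fin k} (he : ∀ i, i ≤ e) {m : ℕ} {s : Str k K} (hs : s ∉ prefixed K e m) :
    lexCdf p s + strP p s ≤ 1 - p e ^ m := by
  have he1 : p e ≤ 1 := by linarith [letterCdf_add_le_one hpos hsum e, letterCdf_nonneg hpos e]
  induction m generalizing K with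
  | zero => simp [prefixed_zero] at hs
  | succ m ih =>
    rcases K with _ | K
    · exact absurd (Finset.mem_filter.2 ⟨Finset.mem_univ _, fun j => j.elim0⟩) hs
    obtain ⟨c, t, rfl⟩ : ∃ c t, s = (Fin.cons c t : Str k (K + 1)) :=
      ⟨_, _, (Fin.cons_self_tail s).symm⟩
    rw [lexCdf_cons' hsum, strP_cons, pow_succ']
    have he2 := letterCdf_add_eq_one hsum he
    by_cases hc : c = e
    · subst hc
      have := mul_le_mul_of_nonneg_left (ih fun h => hs (cons_mem_prefixed.2 ⟨rfl, h⟩)) (hpos c).le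
      linarith
    · have h1 := letterCdf_add_le hpos (lt_of_le_of_ne (he c) hc)
      have h2 := mul_le_of_le_one_right (hpos e).le (pow_le_one₀ (n := m) (hpos e).le he1)
      have h3 := mul_le_mul_of_nonneg_left (lexCdf_add_strP_le_one hpos hsum t) (hpos c).le
      linarith

end Prefixes

section Blocks

variable {k : ℕ} {p : Fin k → ℝ}

lemma sum_sq_edgeMass_le (hpos : ∀ i, 0 < p i) (hsum : ∑ i, p i = 1) {b g θ : ℝ} (hb : 0 < b)
    (hb1 : b ≤ 1) (hbp : ∀ i, b ≤ p i) (hg : ∑ i, p i ^ 2 = g) (hθ : ∑ i, p i ^ θ = g ^ 2)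
    (hθ1 : 1 ≤ θ) (hθ4 : θ ≤ 4) (e : Fin k) {n m N : ℕ} (hN : 4 ≤ N) {x Y R : ℝ}
    (hx : x = N * p e ^ m) (hx1 : 1 ≤ x) (hR : 0 ≤ R) (hY : Y ≤ 1)
    (hgY : x ^ ((3 + θ) / 2) * g ^ (2 * n) ≤ Y) {T : Finset (Str k (n + m))}
    (hT : T ⊆ prefixed (n + m) e m)
    (hvar : ∀ s ∈ T, ∀ y, lexCdf p s ≤ y → y ≤ lexCdf p s + strP p s →
      b ^ 2 * p e ^ m ≤ y * (1 - y) ∧ y * (1 - y) ≤ p e ^ m) :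
    ∑ i ∈ range N, (∑ s ∈ T, edgeMass N p s i) ^ 2 ≤
      2 * ((2 * R + 2) * (√(Real.pi ^ 3 / b ^ 2) * (1 / b) ^ (4 - θ) * Y)) +
        2 * (N * ((N : ℝ) ^ 2 * Real.exp (3 - R)) ^ 2) := by
  have hx0 : 0 < x := by linarith
  have hN0 : (0 : ℝ) < N := by positivity
  have hV : 0 < p e ^ m := pow_pos (hpos e) m
  have hg0 : 0 ≤ g := hg ▸ Finset.sum_nonneg fun i _ => sq_nonneg _
  have hpa : ∀ i, p i ≤ √g := fun i => Real.le_sqrt_of_sq_le <| hg ▸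
    Finset.single_le_sum (f := fun i => p i ^ 2) (fun j _ => sq_nonneg _) (Finset.mem_univ i)
  have hsx : 0 < √x := Real.sqrt_pos.2 hx0
  have hsxx : √x * √x = x := Real.mul_self_sqrt hx0.le
  have hsx1 : 1 ≤ √x := Real.one_le_sqrt.2 hx1
  have hgn : √g ^ n ≤ 1 / √x := by
    refine le_of_pow_le_pow_left₀ (n := 4) (by norm_num) (by positivity) ?_
    have h1 : (√g ^ n) ^ 4 = g ^ (2 * n) := by
      rw [← pow_mul, mul_comm n 4, pow_mul, pow_mul]
      congr 1
      rw [show 4 = 2 * 2 by rfl, pow_mul, Real.sq_sqrt hg0]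
    have h2 : (1 / √x) ^ 4 = 1 / x ^ 2 := by
      rw [div_pow, one_pow, show 4 = 2 * 2 by rfl, pow_mul, Real.sq_sqrt hx0.le]
    rw [h1, h2, le_div_iff₀ (by positivity), mul_comm]
    refine le_trans ?_ (hgY.trans hY)
    refine mul_le_mul_of_nonneg_right ?_ (by positivity)
    rw [← Real.rpow_natCast]
    exact Real.rpow_le_rpow_of_exponent_le hx1 (by push_cast; linarith)
  obtain ⟨α, hα, hαsum⟩ := exists_cellMap_prefixed hpos hsum e
    (let ⟨α, _, h2, h3⟩ := exists_cellMap hpos hsum hb hb1 hbp hpa hg hθ hθ4 n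
      (show 0 < 1 / √x by positivity) ((div_le_one hsx).2 hsx1) hgn
    ⟨α, h2, h3⟩) m
  have hmul : ∀ s ∈ T, (N : ℝ) * strP p s ≤ √x := fun s hs => by
    have h1 := strP_le_of_mem_prefixed hpos hpa (hT hs)
    calc (N : ℝ) * strP p s ≤ N * (p e ^ m * (1 / √x)) := by gcongr; exact h1.trans (by gcongr)
      _ = √x := by
        rw [← mul_assoc, ← hx, mul_one_div, div_eq_iff hsx.ne', hsxx]
  have hw1 : ∑ s ∈ T, strP p s ^ 2 ≤ 1 := by
    rw [← sum_strP (K := n + m) hsum]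
    refine (Finset.sum_le_sum_of_subset_of_nonneg (Finset.subset_univ T)
      fun _ _ _ => sq_nonneg _).trans (Finset.sum_le_sum fun s _ => ?_)
    have h1 := lexCdf_add_strP_le_one hpos hsum s
    have h2 := lexCdf_nonneg hpos s
    have h3 := strP_pos hpos s
    nlinarith
  have hprec : ∀ s ∈ T, ∀ (j m' : Fin N),
      b ^ 2 * p e ^ m ≤ precProb p s j m' * (1 - precProb p s j m') ∧
      precProb p s j m' * (1 - precProb p s j m') ≤ p e ^ m := fun s hs j m' =>
    let h := precProb_mem hpos hsum s j m'
    hvar s hs _ h.1 h.2.1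
  have hmain := sum_sq_le_of_localized (N := N) (T := T) (F := lexCdf p) (α := α)
    (w := fun s => strP p s ^ 2) (B := fun s i => edgeMass N p s i) (ℓ := p e ^ m * (1 / √x))
    (H := R * √x) (M := √(Real.pi ^ 3 / b ^ 2) / √x) (η := Real.exp (3 - R)) (D := (N : ℝ) ^ 2)
    (by omega) (hα.mono hT) (by positivity) (by positivity) (by positivity) (by positivity)
    (by positivity) (fun s => sq_nonneg _) hw1 (fun s i => edgeMass_nonneg hpos s i)
    (fun s hs i => edgeMass_le s i (by positivity) fun j l hjl => by
      rw [hx]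
      exact pairMass_le_div_sqrt hsum hjl s (by positivity) hV hN (fun m' => (hprec s hs j m').1) i)
    (fun s hs i hi => edgeMass_le s i (by positivity) fun j l hjl => by
      have h := pairMass_tail hpos hsum hjl s (fun m' => (hprec s hs j m').2) (hx ▸ hx1)
        (hx ▸ hmul s hs) i hi
      rwa [← hx, mul_div_cancel_right₀ _ hsx.ne'] at h)
    (fun s _ => sum_edgeMass_le hpos hsum s _)
  refine hmain.trans ?_
  have hlen : 2 * (R * √x) / (N * (p e ^ m * (1 / √x))) = 2 * R := by
    rw [← mul_assoc (N : ℝ), ← hx, mul_one_div, Real.div_sqrt]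
    field_simp
  have hcells : ∑ s ∈ T, ∑ t ∈ T, (if α s = α t then strP p s ^ 2 * strP p t ^ 2 else 0) ≤
      (p e ^ m) ^ 4 * ((1 / √x / b) ^ (4 - θ) * g ^ (2 * n)) := by
    refine le_trans ?_ hαsum
    have hnn : ∀ s t, (0 : ℝ) ≤ if α s = α t then strP p s ^ 2 * strP p t ^ 2 else 0 :=
      fun s t => by split_ifs <;> positivity
    exact (Finset.sum_le_sum fun s _ => Finset.sum_le_sum_of_subset_of_nonneg hT
      fun t _ _ => hnn s t).trans (Finset.sum_le_sum_of_subset_of_nonneg hT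
      fun s _ _ => Finset.sum_nonneg fun t _ => hnn s t)
  have hpow : x ^ 4 / √x * (1 / √x) ^ (4 - θ) = x ^ ((3 + θ) / 2) := by
    rw [Real.sqrt_eq_rpow, one_div (x ^ (1 / 2 : ℝ)), ← Real.rpow_neg hx0.le,
      ← Real.rpow_mul hx0.le, ← Real.rpow_natCast, ← Real.rpow_sub hx0, ← Real.rpow_add hx0]
    congr 1
    push_cast
    ring
  have hbound : ((N : ℝ) ^ 2) ^ 2 * (√(Real.pi ^ 3 / b ^ 2) / √x) *
      ∑ s ∈ T, ∑ t ∈ T, (if α s = α t then strP p s ^ 2 * strP p t ^ 2 else 0) ≤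
      √(Real.pi ^ 3 / b ^ 2) * (1 / b) ^ (4 - θ) * Y := by
    calc _ ≤ ((N : ℝ) ^ 2) ^ 2 * (√(Real.pi ^ 3 / b ^ 2) / √x) *
          ((p e ^ m) ^ 4 * ((1 / √x / b) ^ (4 - θ) * g ^ (2 * n))) := by gcongr
      _ = √(Real.pi ^ 3 / b ^ 2) * (1 / b) ^ (4 - θ) *
          ((N * p e ^ m) ^ 4 / √x * (1 / √x) ^ (4 - θ) * g ^ (2 * n)) := by
        rw [div_eq_mul_one_div (1 / √x) b, Real.mul_rpow (by positivity) (by positivity)]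
        ring
      _ ≤ _ := by
        rw [← hx, hpow]
        gcongr
  rw [hlen]
  linarith [mul_le_mul_of_nonneg_left hbound (show 0 ≤ 2 * R + 2 by positivity)]

lemma sum_sq_edgeMass_le_of_mul_pow_le (hpos : ∀ i, 0 < p i) (hsum : ∑ i, p i = 1) (e : Fin k)
    {n m N : ℕ} (hx : N * p e ^ m ≤ 1) :
    ∑ i ∈ range N, (∑ s ∈ prefixed (n + m) e m, edgeMass N p s i) ^ 2 ≤
      (∑ i, p i ^ 2) ^ (2 * n) := by
  set A := ∑ s ∈ prefixed (n + m) e m, (N : ℝ) ^ 2 * strP p s ^ 2 with hA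
  have h0 : ∀ i, 0 ≤ ∑ s ∈ prefixed (n + m) e m, edgeMass N p s i := fun i =>
    Finset.sum_nonneg fun s _ => edgeMass_nonneg hpos s i
  have h1 : ∑ i ∈ range N, ∑ s ∈ prefixed (n + m) e m, edgeMass N p s i ≤ A := by
    rw [Finset.sum_comm]
    exact Finset.sum_le_sum fun s _ => sum_edgeMass_le hpos hsum s _
  have hgn : 0 ≤ (∑ i, p i ^ 2) ^ n := pow_nonneg (Finset.sum_nonneg fun i _ => sq_nonneg _) n
  have hA0 : 0 ≤ A := Finset.sum_nonneg fun s _ => by positivity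
  have hA1 : A ≤ (∑ i, p i ^ 2) ^ n := by
    rw [hA, ← Finset.mul_sum, sum_prefixed_strP_sq, ← mul_assoc, ← mul_pow]
    refine mul_le_of_le_one_left hgn (pow_le_one₀ ?_ hx)
    have := hpos e
    positivity
  calc _ ≤ (∑ i ∈ range N, ∑ s ∈ prefixed (n + m) e m, edgeMass N p s i) ^ 2 :=
        Finset.sum_sq_le_sq_sum_of_nonneg fun i _ => h0 i
    _ ≤ ((∑ i, p i ^ 2) ^ n) ^ 2 := by
        gcongr
        · exact Finset.sum_nonneg fun i _ => h0 i
        · exact h1.trans hA1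
    _ = _ := by rw [← pow_mul, mul_comm]

end Blocks

section Classes

variable {k K : ℕ} {p : Fin k → ℝ}

lemma variance_of_mem_prefixed_bot (hpos : ∀ i, 0 < p i) (hsum : ∑ i, p i = 1) {b : ℝ}
    (hb : 0 < b) {e : Fin k} (hbe : b ≤ p e) (heb : p e + b ≤ 1) (he : ∀ i, e ≤ i) {m : ℕ}
    (hm1 : 1 ≤ m) (hm : m ≤ K) {s : Str k K} (hs : s ∈ prefixed K e m \ prefixed K e (m + 1))
    {y : ℝ} (hy : lexCdf p s ≤ y) (hy' : y ≤ lexCdf p s + strP p s) :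
    b ^ 2 * p e ^ m ≤ y * (1 - y) ∧ y * (1 - y) ≤ p e ^ m := by
  obtain ⟨h1, h2⟩ := Finset.mem_sdiff.1 hs
  have h3 := lexCdf_add_strP_le_of_mem_prefixed hpos hsum he hm h1
  have h4 := pow_le_lexCdf_of_notMem_prefixed hpos hsum he h2
  have h5 : p e ^ m ≤ p e := pow_le_of_le_one (hpos e).le (by linarith) (by omega)
  have h6 : 0 < p e ^ m := pow_pos (hpos e) m
  have h7 : b * p e ^ m ≤ y := by
    refine le_trans ?_ (h4.trans hy)
    rw [pow_succ']
    gcongr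
  have h8 : b ≤ 1 - y := by linarith
  have h9 : 0 < b * p e ^ m := by positivity
  refine ⟨?_, by nlinarith⟩
  calc b ^ 2 * p e ^ m = b * p e ^ m * b := by ring
    _ ≤ y * (1 - y) := mul_le_mul h7 h8 hb.le (h9.le.trans h7)

lemma variance_of_mem_prefixed_top (hpos : ∀ i, 0 < p i) (hsum : ∑ i, p i = 1) {b : ℝ}
    (hb : 0 < b) {e : Fin k} (hbe : b ≤ p e) (heb : p e + b ≤ 1) (he : ∀ i, i ≤ e) {m : ℕ}
    (hm1 : 1 ≤ m) (hm : m ≤ K) {s : Str k K} (hs : s ∈ prefixed K e m \ prefixed K e (m + 1))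
    {y : ℝ} (hy : lexCdf p s ≤ y) (hy' : y ≤ lexCdf p s + strP p s) :
    b ^ 2 * p e ^ m ≤ y * (1 - y) ∧ y * (1 - y) ≤ p e ^ m := by
  obtain ⟨h1, h2⟩ := Finset.mem_sdiff.1 hs
  have h3 := one_sub_pow_le_lexCdf_of_mem_prefixed hpos hsum he hm h1
  have h4 := lexCdf_add_strP_le_of_notMem_prefixed hpos hsum he h2
  have h5 : p e ^ m ≤ p e := pow_le_of_le_one (hpos e).le (by linarith) (by omega)
  have h6 : 0 < p e ^ m := pow_pos (hpos e) m
  have h7 : b * p e ^ m ≤ 1 - y := by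
    have : b * p e ^ m ≤ p e ^ (m + 1) := by
      rw [pow_succ']
      gcongr
    linarith
  have h8 : b ≤ y := by linarith
  have h9 : 0 < b * p e ^ m := by positivity
  refine ⟨?_, by nlinarith⟩
  calc b ^ 2 * p e ^ m = b * (b * p e ^ m) := by ring
    _ ≤ y * (1 - y) := mul_le_mul h8 h7 h9.le (hb.le.trans h8)

lemma variance_of_notMem_prefixed (hpos : ∀ i, 0 < p i) (hsum : ∑ i, p i = 1) {b : ℝ}
    (hb : 0 < b) {e₀ e₁ : Fin k} (hbe₀ : b ≤ p e₀) (hbe₁ : b ≤ p e₁) (he₀ : ∀ i, e₀ ≤ i)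
    (he₁ : ∀ i, i ≤ e₁) {s : Str k K} (hs₀ : s ∉ prefixed K e₀ 1) (hs₁ : s ∉ prefixed K e₁ 1)
    {y : ℝ} (hy : lexCdf p s ≤ y) (hy' : y ≤ lexCdf p s + strP p s) :
    b ^ 2 ≤ y * (1 - y) ∧ y * (1 - y) ≤ 1 := by
  have h1 := pow_le_lexCdf_of_notMem_prefixed hpos hsum he₀ hs₀
  have h2 := lexCdf_add_strP_le_of_notMem_prefixed hpos hsum he₁ hs₁
  rw [pow_one] at h1 h2
  constructor
  · rw [sq]
    exact mul_le_mul (by linarith) (by linarith) hb.le (by linarith)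
  · nlinarith [sq_nonneg y]

lemma sum_prefixed_one_eq (e : Fin k) (f : Str k K → ℝ) (M : ℕ) :
    ∑ s ∈ prefixed K e 1, f s =
      ∑ m ∈ range M, ∑ s ∈ prefixed K e (m + 1) \ prefixed K e (m + 2), f s +
        ∑ s ∈ prefixed K e (M + 1), f s := by
  induction M with
  | zero => simp
  | succ M ih =>
    rw [ih, Finset.sum_range_succ, add_assoc,
      Finset.sum_sdiff (prefixed_anti e (show M + 1 ≤ M + 2 by omega))]

lemma sum_sq_prefixed_one_le (e : Fin k) (f : Str k K → ℕ → ℝ) {B : ℝ} {M N : ℕ} (hM : 1 ≤ M)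
    (hclass : ∀ m, 1 ≤ m → m < M →
      ∑ i ∈ range N, (∑ s ∈ prefixed K e m \ prefixed K e (m + 1), f s i) ^ 2 ≤ B)
    (hlast : ∑ i ∈ range N, (∑ s ∈ prefixed K e M, f s i) ^ 2 ≤ B) :
    ∑ i ∈ range N, (∑ s ∈ prefixed K e 1, f s i) ^ 2 ≤ 2 * (M : ℝ) ^ 2 * B := by
  obtain ⟨M, rfl⟩ := Nat.exists_eq_add_one_of_ne_zero (show M ≠ 0 by omega)
  have hB : 0 ≤ B := (Finset.sum_nonneg fun i _ => sq_nonneg _).trans hlast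
  have h1 : ∀ i, (∑ s ∈ prefixed K e 1, f s i) ^ 2 ≤
      2 * M * ∑ m ∈ range M, (∑ s ∈ prefixed K e (m + 1) \ prefixed K e (m + 2), f s i) ^ 2 +
        2 * (∑ s ∈ prefixed K e (M + 1), f s i) ^ 2 := by
    intro i
    rw [sum_prefixed_one_eq e (fun s => f s i) M]
    have h2 := sq_sum_le_card_mul_sum_sq (s := range M)
      (f := fun m => ∑ s ∈ prefixed K e (m + 1) \ prefixed K e (m + 2), f s i)
    rw [Finset.card_range] at h2
    refine add_sq_le.trans ?_
    linarith
  calc _ ≤ ∑ i ∈ range N, (2 * M * ∑ m ∈ range M,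
          (∑ s ∈ prefixed K e (m + 1) \ prefixed K e (m + 2), f s i) ^ 2 +
        2 * (∑ s ∈ prefixed K e (M + 1), f s i) ^ 2) := Finset.sum_le_sum fun i _ => h1 i
    _ = 2 * M * ∑ m ∈ range M, ∑ i ∈ range N,
          (∑ s ∈ prefixed K e (m + 1) \ prefixed K e (m + 2), f s i) ^ 2 +
        2 * ∑ i ∈ range N, (∑ s ∈ prefixed K e (M + 1), f s i) ^ 2 := by
      rw [Finset.sum_add_distrib, ← Finset.mul_sum, ← Finset.mul_sum, Finset.sum_comm]
    _ ≤ 2 * M * ∑ m ∈ range M, B + 2 * B := by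
      gcongr with m hm
      exact hclass (m + 1) (by omega) (by have := Finset.mem_range.1 hm; omega)
    _ ≤ _ := by
      rw [Finset.sum_const, Finset.card_range, nsmul_eq_mul]
      push_cast
      have := mul_nonneg (Nat.cast_nonneg (α := ℝ) M) hB
      nlinarith

lemma sum_sq_sum_edgeMass_le (hpos : ∀ i, 0 < p i) (hsum : ∑ i, p i = 1) {b g θ : ℝ} (hb : 0 < b)
    (hbp : ∀ i, b ≤ p i) (hpb : ∀ i, p i + b ≤ 1) (hg : ∑ i, p i ^ 2 = g)
    (hθ : ∑ i, p i ^ θ = g ^ 2) (hθ1 : 1 ≤ θ) (hθ4 : θ ≤ 4) {e₀ e₁ : Fin k}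
    (he₀ : ∀ i, e₀ ≤ i) (he₁ : ∀ i, i ≤ e₁) {N : ℕ} (hN : 4 ≤ N) {Y R B : ℝ} (hR : 0 ≤ R)
    (hY : Y ≤ 1) (hB : 2 * ((2 * R + 2) * (√(Real.pi ^ 3 / b ^ 2) * (1 / b) ^ (4 - θ) * Y)) +
        2 * (N * ((N : ℝ) ^ 2 * Real.exp (3 - R)) ^ 2) ≤ B) (M : Fin k → ℕ)
    (hM1 : ∀ e, 1 ≤ M e) (hMK : ∀ e, e = e₀ ∨ e = e₁ → M e ≤ K)
    (hM : ∀ e, e = e₀ ∨ e = e₁ → N * p e ^ M e ≤ 1 ∧ g ^ (2 * (K - M e)) ≤ B)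
    (hgY : ∀ e, e = e₀ ∨ e = e₁ → ∀ m, m < M e → 1 ≤ N * p e ^ m ∧
      (N * p e ^ m) ^ ((3 + θ) / 2) * g ^ (2 * (K - m)) ≤ Y) :
    ∑ i ∈ range N, (∑ s : Str k K, edgeMass N p s i) ^ 2 ≤
      3 * (1 + 2 * (M e₀ : ℝ) ^ 2 + 2 * (M e₁ : ℝ) ^ 2) * B := by
  have hb1 : b ≤ 1 := by linarith [hpos e₀, hpb e₀]
  have hblock : ∀ e, e = e₀ ∨ e = e₁ → ∀ m, m < M e → ∀ T ⊆ prefixed K e m,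
      (∀ s ∈ T, ∀ y, lexCdf p s ≤ y → y ≤ lexCdf p s + strP p s →
        b ^ 2 * p e ^ m ≤ y * (1 - y) ∧ y * (1 - y) ≤ p e ^ m) →
      ∑ i ∈ range N, (∑ s ∈ T, edgeMass N p s i) ^ 2 ≤ B := by
    intro e he m hm T hT hvar
    obtain ⟨h1, h2⟩ := hgY e he m hm
    obtain ⟨n, rfl⟩ := Nat.exists_eq_add_of_le' (hm.le.trans (hMK e he))
    rw [Nat.add_sub_cancel] at h2
    exact (sum_sq_edgeMass_le hpos hsum hb hb1 hbp hg hθ hθ1 hθ4 e hN rfl h1 hR hY h2 hT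
      hvar).trans hB
  have hlast : ∀ e, e = e₀ ∨ e = e₁ →
      ∑ i ∈ range N, (∑ s ∈ prefixed K e (M e), edgeMass N p s i) ^ 2 ≤ B := by
    intro e he
    obtain ⟨h1, h2⟩ := hM e he
    obtain ⟨n, hn⟩ := Nat.exists_eq_add_of_le' (hMK e he)
    generalize M e = m at h1 h2 hn ⊢
    subst hn
    rw [Nat.add_sub_cancel, ← hg] at h2
    exact (sum_sq_edgeMass_le_of_mul_pow_le hpos hsum e h1).trans h2
  have h₀ := sum_sq_prefixed_one_le e₀ (fun s : Str k K => edgeMass N p s) (hM1 e₀)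
    (fun m hm1 hm => hblock e₀ (Or.inl rfl) m hm _ Finset.sdiff_subset fun s hs y hy hy' =>
      variance_of_mem_prefixed_bot hpos hsum hb (hbp e₀) (hpb e₀) he₀ hm1
        (hm.le.trans (hMK e₀ (Or.inl rfl))) hs hy hy') (hlast e₀ (Or.inl rfl))
  have h₁ := sum_sq_prefixed_one_le e₁ (fun s : Str k K => edgeMass N p s) (hM1 e₁)
    (fun m hm1 hm => hblock e₁ (Or.inr rfl) m hm _ Finset.sdiff_subset fun s hs y hy hy' =>
      variance_of_mem_prefixed_top hpos hsum hb (hbp e₁) (hpb e₁) he₁ hm1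
        (hm.le.trans (hMK e₁ (Or.inr rfl))) hs hy hy') (hlast e₁ (Or.inr rfl))
  have h₂ := hblock e₀ (Or.inl rfl) 0 (hM1 e₀) (univ \ (prefixed K e₀ 1 ∪ prefixed K e₁ 1))
    (by simp [prefixed_zero]) fun s hs y hy hy' => by
      simp only [Finset.mem_sdiff, Finset.mem_union, not_or] at hs
      simpa using variance_of_notMem_prefixed hpos hsum hb (hbp e₀) (hbp e₁) he₀ he₁ hs.2.1 hs.2.2
        hy hy'
  have hsplit : ∀ i, ∑ s : Str k K, edgeMass N p s i ≤
      ∑ s ∈ univ \ (prefixed K e₀ 1 ∪ prefixed K e₁ 1), edgeMass N p s i +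
        (∑ s ∈ prefixed K e₀ 1, edgeMass N p s i + ∑ s ∈ prefixed K e₁ 1, edgeMass N p s i) := by
    intro i
    rw [← Finset.sum_sdiff (Finset.subset_univ (prefixed K e₀ 1 ∪ prefixed K e₁ 1))]
    have h := Finset.sum_union_inter (s₁ := prefixed K e₀ 1) (s₂ := prefixed K e₁ 1)
      (f := fun s => edgeMass N p s i)
    have : 0 ≤ ∑ s ∈ prefixed K e₀ 1 ∩ prefixed K e₁ 1, edgeMass N p s i :=
      Finset.sum_nonneg fun s _ => edgeMass_nonneg hpos s i
    linarith
  calc _ ≤ ∑ i ∈ range N,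
        3 * ((∑ s ∈ univ \ (prefixed K e₀ 1 ∪ prefixed K e₁ 1), edgeMass N p s i) ^ 2 +
          (∑ s ∈ prefixed K e₀ 1, edgeMass N p s i) ^ 2 +
            (∑ s ∈ prefixed K e₁ 1, edgeMass N p s i) ^ 2) := by
        refine Finset.sum_le_sum fun i _ => (pow_le_pow_left₀
          (Finset.sum_nonneg fun s _ => edgeMass_nonneg hpos s i) (hsplit i) 2).trans ?_
        generalize ∑ s ∈ univ \ (prefixed K e₀ 1 ∪ prefixed K e₁ 1), edgeMass N p s i = x
        generalize ∑ s ∈ prefixed K e₀ 1, edgeMass N p s i = y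
        generalize ∑ s ∈ prefixed K e₁ 1, edgeMass N p s i = z
        linarith [sq_nonneg (x - y), sq_nonneg (y - z), sq_nonneg (x - z)]
    _ ≤ _ := by
        rw [← Finset.mul_sum, Finset.sum_add_distrib, Finset.sum_add_distrib]
        linarith

end Classes

section Exponents

variable {k : ℕ} {p : Fin k → ℝ}

lemma phi_two (p : Fin k → ℝ) : phi p 2 = ∑ i, p i ^ 2 := by
  simp [phi]

lemma one_lt_and_le_four_of_phi_eq [Nonempty (Fin k)] (hpos : ∀ i, 0 < p i) (hsum : ∑ i, p i = 1)
    (hlt : ∀ i, p i < 1) {θ : ℝ} (hθ : phi p θ = (phi p 2) ^ 2) : 1 < θ ∧ θ ≤ 4 := by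
  rw [phi_two, phi] at hθ
  have hg1 : ∑ i, p i ^ 2 < 1 := by
    rw [← hsum]
    refine Finset.sum_lt_sum_of_nonempty Finset.univ_nonempty fun i _ => ?_
    nlinarith [hpos i, hlt i]
  have hg0 : 0 ≤ ∑ i, p i ^ 2 := Finset.sum_nonneg fun i _ => sq_nonneg _
  constructor
  · by_contra! h
    have : (1 : ℝ) ≤ ∑ i, p i ^ θ := by
      rw [← hsum]
      refine Finset.sum_le_sum fun i _ => ?_
      simpa using Real.rpow_le_rpow_of_exponent_ge (hpos i) (hlt i).le h
    nlinarith
  · by_contra! h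
    have h1 : ∑ i, p i ^ θ < ∑ i, p i ^ 4 := by
      refine Finset.sum_lt_sum_of_nonempty Finset.univ_nonempty fun i _ => ?_
      have := Real.rpow_lt_rpow_of_exponent_gt (hpos i) (hlt i) h
      exact_mod_cast this
    have h2 : ∑ i, p i ^ 4 ≤ (∑ i, p i ^ 2) ^ 2 := by
      refine le_trans (le_of_eq ?_) (Finset.sum_sq_le_sq_sum_of_nonneg fun i _ => sq_nonneg (p i))
      exact Finset.sum_congr rfl fun i _ => by ring
    linarith

/-- The exponent of a block of strings starting with `m` letters of probability `q`. -/
lemma rpow_mul_pow_le {N K m : ℕ} {q g θ C ε : ℝ} (hN : 0 < (N : ℝ)) (hq : 0 < q) (hq1 : q < 1)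
    (hg : 0 < g) (hg1 : g < 1) (hmK : m ≤ K) (hx : 1 ≤ N * q ^ m)
    (hC : (3 + θ) / (4 * -Real.log g) ≤ C) (hCq : 1 / Real.log (1 / q) ≤ C)
    (hK : (C + ε) * Real.log N ≤ K) :
    (N * q ^ m) ^ ((3 + θ) / 2) * g ^ (2 * (K - m)) ≤ (N : ℝ) ^ (-(2 * (-Real.log g * ε))) := by
  have hx0 : 0 < N * q ^ m := by linarith
  have hlq : 0 < Real.log (1 / q) := Real.log_pos ((one_lt_div hq).2 hq1)
  have hlg : 0 < -Real.log g := by linarith [Real.log_neg hg hg1]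
  have hlogx : Real.log (N * q ^ m) = Real.log N - m * Real.log (1 / q) := by
    rw [Real.log_mul hN.ne' (by positivity), Real.log_pow, one_div, Real.log_inv]
    ring
  have hl0 : 0 ≤ Real.log N - m * Real.log (1 / q) := hlogx ▸ Real.log_nonneg hx
  rw [div_le_iff₀ hlq] at hCq
  rw [div_le_iff₀ (by positivity)] at hC
  rw [← Real.log_le_log_iff (by positivity) (by positivity),
    Real.log_mul (by positivity) (by positivity), Real.log_rpow hx0, Real.log_rpow hN, Real.log_pow,
    hlogx]
  push_cast [Nat.cast_sub hmK]
  set L := Real.log N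
  set r := Real.log (1 / q)
  set ψ := -Real.log g with hψ
  have h1 : Real.log g = -ψ := by rw [hψ, neg_neg]
  rw [h1]
  have h2 : (3 + θ) * (L - m * r) ≤ C * (4 * ψ) * (L - m * r) :=
    mul_le_mul_of_nonneg_right hC hl0
  have h3 : (m : ℝ) ≤ m * (C * r) := le_mul_of_one_le_right (Nat.cast_nonneg m) hCq
  have h4 : ψ * ((C + ε) * L - m + m * (1 - C * r)) ≤ ψ * (K - m) := by
    refine mul_le_mul_of_nonneg_left ?_ hlg.le
    linarith
  linarith

end Exponents

section Asymptotics

lemma exists_pow_mul_exp_neg_le {δ : ℝ} (hδ : 0 < δ) (s : ℝ) :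
    ∃ C : ℝ, 0 < C ∧ ∀ x : ℝ, 1 ≤ x → Real.exp (-x ^ δ) ≤ C * x ^ (-s) := by
  obtain ⟨n, hn⟩ := exists_nat_ge (s / δ)
  refine ⟨n.factorial, by positivity, fun x hx => ?_⟩
  have hx0 : 0 < x := by linarith
  have h1 := Real.pow_div_factorial_le_exp (x ^ δ) (by positivity) n
  have h2 : x ^ s ≤ (x ^ δ) ^ n := by
    rw [← Real.rpow_natCast, ← Real.rpow_mul hx0.le]
    refine Real.rpow_le_rpow_of_exponent_le hx ?_
    rw [div_le_iff₀ hδ] at hn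
    linarith
  rw [div_le_iff₀ (by positivity)] at h1
  rw [Real.exp_neg, Real.rpow_neg hx0.le, ← div_eq_mul_inv, inv_le_comm₀ (by positivity)
    (by positivity), inv_div, div_le_iff₀ (by positivity)]
  linarith

lemma exists_ceil_bounds {N K : ℕ} {q g C ε : ℝ} (hN : 1 < (N : ℝ)) (hq : 0 < q) (hq1 : q < 1)
    (hg : 0 < g) (hg1 : g < 1) (hCq : 1 / Real.log (1 / q) ≤ C)
    (hK : (C + ε) * Real.log N ≤ K) (hε : 1 ≤ ε * Real.log N) :
    ∃ M : ℕ, 1 ≤ M ∧ M ≤ K ∧ N * q ^ M ≤ 1 ∧ (∀ m, m < M → 1 ≤ N * q ^ m) ∧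
      g ^ (2 * (K - M)) ≤ g ^ (-2 : ℝ) * (N : ℝ) ^ (-(2 * (-Real.log g * ε))) ∧
      (M : ℝ) ≤ 1 / Real.log (1 / q) * Real.log N + 1 := by
  have hN0 : 0 < (N : ℝ) := by linarith
  have hL : 0 < Real.log N := Real.log_pos hN
  have hlq : 0 < Real.log (1 / q) := Real.log_pos ((one_lt_div hq).2 hq1)
  have hlg : 0 < -Real.log g := by linarith [Real.log_neg hg hg1]
  have hlogx : ∀ m : ℕ, Real.log (N * q ^ m) = Real.log N - m * Real.log (1 / q) := fun m => by
    rw [Real.log_mul hN0.ne' (by positivity), Real.log_pow, one_div, Real.log_inv]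
    ring
  set t := 1 / Real.log (1 / q) * Real.log N with ht
  have ht0 : 0 < t := by positivity
  have htl : t * Real.log (1 / q) = Real.log N := by
    rw [ht]
    field_simp
  have hM1 := Nat.le_ceil t
  have hM2 := Nat.ceil_lt_add_one ht0.le
  have hKt : t + ε * Real.log N ≤ K := by
    have := mul_le_mul_of_nonneg_right hCq hL.le
    linarith
  have hMK : ⌈t⌉₊ ≤ K := Nat.ceil_le.2 (by linarith)
  refine ⟨⌈t⌉₊, Nat.ceil_pos.2 ht0, hMK, ?_, fun m hm => ?_, ?_, hM2.le⟩
  · rw [← Real.log_nonpos_iff (by positivity), hlogx]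
    have := mul_le_mul_of_nonneg_right hM1 hlq.le
    linarith
  · rw [← Real.log_nonneg_iff (by positivity), hlogx]
    have := mul_le_mul_of_nonneg_right (Nat.lt_ceil.1 hm).le hlq.le
    linarith
  · rw [← Real.log_le_log_iff (by positivity) (by positivity),
      Real.log_mul (by positivity) (by positivity), Real.log_rpow hg, Real.log_rpow hN0,
      Real.log_pow]
    push_cast [Nat.cast_sub hMK]
    have := mul_le_mul_of_nonneg_left (show ε * Real.log N - 1 ≤ K - (⌈t⌉₊ : ℝ) by linarith) hlg.le
    linarith

lemma log_le_rpow_div_bound {x δ r : ℝ} (hx : 1 ≤ x) (hδ : 0 < δ) (hr : 0 ≤ r) :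
    r * Real.log x + 1 ≤ (r / δ + 1) * x ^ δ := by
  have h1 := mul_le_mul_of_nonneg_left (Real.log_le_rpow_div (by linarith : 0 ≤ x) hδ) hr
  have h2 := Real.one_le_rpow hx hδ.le
  calc r * Real.log x + 1 ≤ r * (x ^ δ / δ) + x ^ δ := add_le_add h1 h2
    _ = _ := by ring

end Asymptotics

section Main

variable {k : ℕ} {p : Fin k → ℝ}

lemma exists_sum_sq_sum_edgeMass_le (hpos : ∀ i, 0 < p i) (hsum : ∑ i, p i = 1) {b g θ : ℝ}
    (hb : 0 < b) (hbp : ∀ i, b ≤ p i) (hpb : ∀ i, p i + b ≤ 1) (hg : ∑ i, p i ^ 2 = g)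
    (hg0 : 0 < g) (hg1 : g < 1) (hθ : ∑ i, p i ^ θ = g ^ 2) (hθ1 : 1 ≤ θ) (hθ4 : θ ≤ 4)
    {e₀ e₁ : Fin k} (he₀ : ∀ i, e₀ ≤ i) (he₁ : ∀ i, i ≤ e₁) {C ε : ℝ} (hε : 0 < ε)
    (hC : (3 + θ) / (4 * -Real.log g) ≤ C) (hC₀ : 1 / Real.log (1 / p e₀) ≤ C)
    (hC₁ : 1 / Real.log (1 / p e₁) ≤ C) :
    ∃ A : ℝ, ∀ N K : ℕ, 4 ≤ N → 1 ≤ ε * Real.log N → (C + ε) * Real.log N ≤ K →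
      ∑ i ∈ range N, (∑ s : Str k K, edgeMass N p s i) ^ 2 ≤
        A * (N : ℝ) ^ (-(-Real.log g * ε)) := by
  have hp1 : ∀ i, p i < 1 := fun i => by linarith [hpb i]
  have hlg : 0 < -Real.log g := by linarith [Real.log_neg hg0 hg1]
  obtain ⟨δ, hδ⟩ : ∃ δ, δ = -Real.log g * ε / 3 := ⟨_, rfl⟩
  have hδ0 : 0 < δ := by rw [hδ]; positivity
  have hψ : -Real.log g * ε = 3 * δ := by rw [hδ]; ring
  obtain ⟨C₂, hC₂, hexp⟩ := exists_pow_mul_exp_neg_le hδ0 (5 + 6 * δ)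
  set c := √(Real.pi ^ 3 / b ^ 2) * (1 / b) ^ (4 - θ) with hc
  have hc0 : 0 ≤ c := by positivity
  have hr : ∀ e, 0 < 1 / Real.log (1 / p e) := fun e =>
    one_div_pos.2 (Real.log_pos ((one_lt_div (hpos e)).2 (hp1 e)))
  set d : Fin k → ℝ := fun e => 1 / Real.log (1 / p e) / δ + 1 with hd
  have hd0 : ∀ e, 0 ≤ d e := fun e => by
    have := hr e
    positivity
  set a := 8 * c + 2 * Real.exp 6 * C₂ + g ^ (-2 : ℝ) with ha
  have ha0 : 0 ≤ a := by positivity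
  refine ⟨3 * (1 + 2 * d e₀ ^ 2 + 2 * d e₁ ^ 2) * a, fun N K hN hεN hK => ?_⟩
  have hN1 : 1 < (N : ℝ) := by exact_mod_cast (by omega : 1 < N)
  have hN0 : 0 < (N : ℝ) := by linarith
  set R := (N : ℝ) ^ δ with hR
  set Y := (N : ℝ) ^ (-(2 * (-Real.log g * ε))) with hY
  have hR1 : 1 ≤ R := Real.one_le_rpow hN1.le hδ0.le
  have hY0 : 0 < Y := by positivity
  have hY1 : Y ≤ 1 := Real.rpow_le_one_of_one_le_of_nonpos hN1.le (by rw [hψ]; linarith)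
  have hex : ∀ e, ∃ M : ℕ, 1 ≤ M ∧ ((e = e₀ ∨ e = e₁) → M ≤ K ∧ N * p e ^ M ≤ 1 ∧
      (∀ m, m < M → 1 ≤ N * p e ^ m) ∧ g ^ (2 * (K - M)) ≤ g ^ (-2 : ℝ) * Y ∧
      (M : ℝ) ≤ d e * R) := by
    intro e
    by_cases he : e = e₀ ∨ e = e₁
    · have hCe : 1 / Real.log (1 / p e) ≤ C := by rcases he with rfl | rfl <;> assumption
      obtain ⟨M, h1, h2, h3, h4, h5, h6⟩ :=
        exists_ceil_bounds hN1 (hpos e) (hp1 e) hg0 hg1 hCe hK hεN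
      exact ⟨M, h1, fun _ => ⟨h2, h3, h4, h5, h6.trans
        (log_le_rpow_div_bound hN1.le hδ0 (hr e).le)⟩⟩
    · exact ⟨1, le_rfl, fun h => absurd h he⟩
  choose M hM1 hM using hex
  have hgR : g ^ (-2 : ℝ) * Y ≤ g ^ (-2 : ℝ) * R * Y := by
    rw [mul_right_comm]
    exact le_mul_of_one_le_right (by positivity) hR1
  have htail : (N : ℝ) * ((N : ℝ) ^ 2 * Real.exp (3 - R)) ^ 2 ≤ Real.exp 6 * C₂ * R * Y := by
    have h1 : Real.exp (3 - R) ^ 2 = Real.exp 6 * (Real.exp (-R) * Real.exp (-R)) := by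
      rw [sq, ← Real.exp_add, ← Real.exp_add, ← Real.exp_add]
      congr 1
      ring
    have h2 : Real.exp (-R) ≤ 1 := Real.exp_le_one_iff.2 (by linarith)
    have h3 : (N : ℝ) ^ 5 * (N : ℝ) ^ (-(5 + 6 * δ)) = Y := by
      rw [← Real.rpow_natCast, ← Real.rpow_add hN0, hY, hψ]
      congr 1
      push_cast
      ring
    calc (N : ℝ) * ((N : ℝ) ^ 2 * Real.exp (3 - R)) ^ 2
        = Real.exp 6 * ((N : ℝ) ^ 5 * (Real.exp (-R) * Real.exp (-R))) := by
          rw [mul_pow, h1]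
          ring
      _ ≤ Real.exp 6 * ((N : ℝ) ^ 5 * (C₂ * (N : ℝ) ^ (-(5 + 6 * δ)) * 1)) := by
          gcongr
          exact hexp N hN1.le
      _ = Real.exp 6 * C₂ * 1 * Y := by
          rw [← h3]
          ring
      _ ≤ _ := by gcongr
  have hmain : 2 * ((2 * R + 2) * (c * Y)) +
      2 * (N * ((N : ℝ) ^ 2 * Real.exp (3 - R)) ^ 2) ≤ 8 * c * R * Y +
        2 * Real.exp 6 * C₂ * R * Y := by
    have := mul_le_mul_of_nonneg_right hR1 (mul_nonneg hc0 hY0.le)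
    linarith
  have hgY0 : 0 ≤ g ^ (-2 : ℝ) * R * Y := by positivity
  have hmain0 : 0 ≤ 8 * c * R * Y + 2 * Real.exp 6 * C₂ * R * Y := by positivity
  have haB : a * R * Y = 8 * c * R * Y + 2 * Real.exp 6 * C₂ * R * Y + g ^ (-2 : ℝ) * R * Y := by
    rw [ha]
    ring
  have hfin := sum_sq_sum_edgeMass_le (K := K) hpos hsum hb hbp hpb hg hθ hθ1 hθ4 he₀ he₁ hN
    (R := R) (Y := Y) (B := a * R * Y) (by linarith) hY1 (by linarith) M hM1
    (fun e he => (hM e he).1)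
    (fun e he => ⟨(hM e he).2.1, by linarith [(hM e he).2.2.2.1]⟩)
    (fun e he m hm => ⟨(hM e he).2.2.1 m hm, rpow_mul_pow_le hN0 (hpos e) (hp1 e) hg0 hg1
      (hm.le.trans (hM e he).1) ((hM e he).2.2.1 m hm) hC
      (by rcases he with rfl | rfl <;> assumption) hK⟩)
  have hM₀ := (hM e₀ (Or.inl rfl)).2.2.2.2
  have hM₁ := (hM e₁ (Or.inr rfl)).2.2.2.2
  have hR2 : 1 ≤ R ^ 2 := one_le_pow₀ hR1
  have hRY : R ^ 3 * Y = (N : ℝ) ^ (-(-Real.log g * ε)) := by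
    rw [hR, hY, ← Real.rpow_natCast, ← Real.rpow_mul hN0.le, ← Real.rpow_add hN0, hψ]
    congr 1
    push_cast
    ring
  calc _ ≤ _ := hfin
    _ ≤ 3 * (R ^ 2 + 2 * (d e₀ * R) ^ 2 + 2 * (d e₁ * R) ^ 2) * (a * R * Y) := by gcongr
    _ = 3 * (1 + 2 * d e₀ ^ 2 + 2 * d e₁ ^ 2) * a * (R ^ 3 * Y) := by ring
    _ = _ := by rw [hRY]

end Main

/-- **Proposition (first moment of shared edges)**: for every `p` there is `c = c(p) > 0`
such that for every `ε > 0` there is a constant `A` with: whenever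
`K ≥ (C_p^- + ε) log N`, where `C_p^- = max(C_p, 1/log(1/p₀), 1/log(1/p_{k-1}))`, the expected
number of shared edges of the shuffle graphs of two independent `p`-random sequences of `N`
strings of length `K` is at most `A N^{-cε}`. -/
theorem expected_shared_edges_small (k : ℕ) (hk : 2 ≤ k) (p : Fin k → ℝ)
    (hpos : ∀ i, 0 < p i) (hsum : ∑ i, p i = 1)
    (θ : ℝ) (hθ : phi p θ = (phi p 2) ^ 2) :
    ∃ c : ℝ, 0 < c ∧ ∀ ε : ℝ, 0 < ε → ∃ A : ℝ, ∀ N K : ℕ,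
      (max (Cmain p θ) (max (1 / Real.log (1 / p ⟨0, by omega⟩))
          (1 / Real.log (1 / p ⟨k - 1, by omega⟩))) + ε) * Real.log N ≤ (K : ℝ) →
      ∑ ω : Fin N → Str k K, ∑ ω' : Fin N → Str k K,
          seqP p ω * seqP p ω' *
            ((edgeSet (sortedSeq ω) ∩ edgeSet (sortedSeq ω')).card : ℝ)
        ≤ A * (N : ℝ) ^ (-(c * ε)) := by
  have hk0 : (⟨0, by omega⟩ : Fin k) ≠ ⟨k - 1, by omega⟩ := by
    simp only [ne_eq, Fin.mk.injEq]
    omega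
  have : Nonempty (Fin k) := ⟨⟨0, by omega⟩⟩
  obtain ⟨i₀, hi₀⟩ := Finite.exists_min p
  have hpb : ∀ i, p i + p i₀ ≤ 1 := by
    intro i
    obtain ⟨j, hj⟩ : ∃ j, j ≠ i := by
      by_cases h : i = ⟨0, by omega⟩
      · exact ⟨_, h ▸ hk0.symm⟩
      · exact ⟨_, Ne.symm h⟩
    have h := Finset.sum_le_sum_of_subset_of_nonneg (Finset.subset_univ {i, j})
      fun l _ _ => (hpos l).le
    rw [Finset.sum_pair hj.symm, hsum] at h
    linarith [hi₀ j]
  have hlt : ∀ i, p i < 1 := fun i => by linarith [hpb i, hpos i₀]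
  obtain ⟨hθ1, hθ4⟩ := one_lt_and_le_four_of_phi_eq hpos hsum hlt hθ
  have hg0 : 0 < ∑ i, p i ^ 2 := Finset.sum_pos (fun i _ => pow_pos (hpos i) 2) univ_nonempty
  have hg1 : ∑ i, p i ^ 2 < 1 := by
    rw [← hsum]
    refine Finset.sum_lt_sum_of_nonempty univ_nonempty fun i _ => ?_
    nlinarith [hpos i, hlt i]
  have hlg : 0 < -Real.log (∑ i, p i ^ 2) := by linarith [Real.log_neg hg0 hg1]
  refine ⟨-Real.log (∑ i, p i ^ 2), hlg, fun ε hε => ?_⟩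
  have hψε := mul_pos hlg hε
  obtain ⟨A, hA⟩ := exists_sum_sq_sum_edgeMass_le hpos hsum (hpos i₀) hi₀ hpb rfl hg0 hg1
    (by rwa [phi_two, phi] at hθ) hθ1.le hθ4 (e₀ := ⟨0, by omega⟩)
    (e₁ := ⟨k - 1, by omega⟩) (fun i => Fin.le_def.2 (Nat.zero_le _))
    (fun i => Fin.le_def.2 (Nat.le_sub_one_of_lt i.2))
    (C := max (Cmain p θ) (max (1 / Real.log (1 / p ⟨0, by omega⟩))
      (1 / Real.log (1 / p ⟨k - 1, by omega⟩)))) hε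
    (by simpa only [Cmain, psi, phi_two] using le_max_left _ _)
    ((le_max_left _ _).trans (le_max_right _ _)) ((le_max_right _ _).trans (le_max_right _ _))
  set c := -Real.log (∑ i, p i ^ 2)
  set N₀ := max 4 (Real.exp (1 / ε))
  have hN₀ : 0 < N₀ := by positivity
  refine ⟨max A (N₀ ^ 2 * N₀ ^ (c * ε)), fun N K hK => ?_⟩
  by_cases hN : N₀ ≤ N
  · have hN4 : 4 ≤ N := by exact_mod_cast (le_max_left _ _).trans hN
    have hεN : 1 ≤ ε * Real.log N := by
      have h := Real.log_le_log (Real.exp_pos _) ((le_max_right _ _).trans hN)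
      rw [Real.log_exp, div_le_iff₀ hε] at h
      linarith
    refine (sum_shared_edges_le hpos).trans ((hA N K hN4 hεN hK).trans ?_)
    gcongr
    exact le_max_left _ _
  · push Not at hN
    refine (sum_shared_edges_le_sq hpos hsum).trans ?_
    rcases Nat.eq_zero_or_pos N with rfl | hN1
    · rw [Nat.cast_zero, Real.zero_rpow (by linarith)]
      norm_num
    · have hN1' : (0 : ℝ) < N := by exact_mod_cast hN1
      calc (N : ℝ) ^ 2 = (N : ℝ) ^ 2 * (N : ℝ) ^ (c * ε) * (N : ℝ) ^ (-(c * ε)) := by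
            rw [mul_assoc, ← Real.rpow_add hN1', add_neg_cancel, Real.rpow_zero, mul_one]
        _ ≤ N₀ ^ 2 * N₀ ^ (c * ε) * (N : ℝ) ^ (-(c * ε)) := by gcongr
        _ ≤ _ := by
            gcongr
            exact le_max_right _ _

end RiffleShuffle
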